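/- arXiv:math/0701682 — 2 statements merged into one kernel-verified Lean document; each statement's English description precedes it below -/
import Mathlib

section
/- Let γ > 0 and for each m ∈ ℕ let u_m be the free pluriharmonic function with scalar coefficients (a^{(m)}, b^{(m)}) on the ball of radius γ. Assume that for each m the coefficient pair (a^{(m+1)} − a^{(m)}, b^{(m+1)} − b^{(m)}) defines a positive free pluriharmonic function on the ball of radius γ (i.e., u_{m+1} − u_m ≥ 0 on the ball of every Hilbert space), and that the sequence (a^{(m)}_{g₀})_{m∈ℕ} ⊂ ℂ is bounded. Then there exist coefficients (a, b) satisfying the radius-γ limsup conditions, with associated free pluriharmonic function v, such that for every complex Hilbert space K and every r ∈ [0, γ), sup_{X ∈ [B(K)ⁿ]_r⁻} ‖u_{m,K}(X) − v_K(X)‖ → 0 as m → ∞. -/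
open scoped ENNReal ComplexOrder
open Filter ContinuousLinearMap

noncomputable section

abbrev Word (n : ℕ) := FreeMonoid (Fin n)

/-- The word determined by a tuple of letters. -/
def word {n k : ℕ} (f : Fin k → Fin n) : Word n :=
  FreeMonoid.ofList (List.ofFn f)

/-- The length of a word. -/
def wordLen {n : ℕ} (α : Word n) : ℕ := (FreeMonoid.toList α).length

/-- The product `X_α = X_{i₁} ⋯ X_{i_k}` for `α = g_{i₁} ⋯ g_{i_k}`. -/
def wordProd {n : ℕ} {K : Type} [NormedAddCommGroup K] [InnerProductSpace ℂ K]
    (X : Fin n → K →L[ℂ] K) (α : Word n) : K →L[ℂ] K :=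
  ((FreeMonoid.toList α).map X).prod

/-- `Σ_{|α| = k} a_α X_α`. -/
def truncSum {n : ℕ} {K : Type} [NormedAddCommGroup K] [InnerProductSpace ℂ K]
    (a : Word n → ℂ) (X : Fin n → K →L[ℂ] K) (k : ℕ) : K →L[ℂ] K :=
  ∑ f : Fin k → Fin n, a (word f) • wordProd X (word f)

/-- `Σ_{|α| = k} b_α X_α*`. -/
def truncSumAdj {n : ℕ} {K : Type} [NormedAddCommGroup K] [InnerProductSpace ℂ K]
    [CompleteSpace K] (b : Word n → ℂ) (X : Fin n → K →L[ℂ] K) (k : ℕ) : K →L[ℂ] K :=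
  ∑ f : Fin k → Fin n, b (word f) • adjoint (wordProd X (word f))

/-- The free holomorphic function `f(X) = Σ_k Σ_{|α| = k} a_α X_α`. -/
def holOp {n : ℕ} {K : Type} [NormedAddCommGroup K] [InnerProductSpace ℂ K]
    (a : Word n → ℂ) (X : Fin n → K →L[ℂ] K) : K →L[ℂ] K :=
  ∑' k : ℕ, truncSum a X k

/-- The free pluriharmonic function
`u(X) = Σ_{k ≥ 1} Σ_{|α| = k} b_α X_α* + a_{g₀} I + Σ_{k ≥ 1} Σ_{|α| = k} a_α X_α`. -/
def phOp {n : ℕ} {K : Type} [NormedAddCommGroup K] [InnerProductSpace ℂ K]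
    [CompleteSpace K] (a b : Word n → ℂ) (X : Fin n → K →L[ℂ] K) : K →L[ℂ] K :=
  (∑' k : ℕ, truncSumAdj b X (k + 1)) + a 1 • (1 : K →L[ℂ] K)
    + ∑' k : ℕ, truncSum a X (k + 1)

/-- Membership in the open noncommutative ball of radius `γ`. -/
def inBall {n : ℕ} {K : Type} [NormedAddCommGroup K] [InnerProductSpace ℂ K]
    [CompleteSpace K] (γ : ℝ) (X : Fin n → K →L[ℂ] K) : Prop :=
  ‖∑ i, X i * adjoint (X i)‖ < γ ^ 2

/-- Membership in the closed noncommutative ball of radius `γ`. -/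
def inClosedBall {n : ℕ} {K : Type} [NormedAddCommGroup K] [InnerProductSpace ℂ K]
    [CompleteSpace K] (γ : ℝ) (X : Fin n → K →L[ℂ] K) : Prop :=
  ‖∑ i, X i * adjoint (X i)‖ ≤ γ ^ 2

/-- The radius-`γ` condition `limsup_k (Σ_{|α|=k} |a_α|²)^{1/(2k)} ≤ 1/γ`. -/
def radCond {n : ℕ} (γ : ℝ) (a : Word n → ℂ) : Prop :=
  Filter.limsup
    (fun k : ℕ =>
      (∑ f : Fin k → Fin n, (‖a (word f)‖₊ : ℝ≥0∞) ^ 2) ^ ((1 : ℝ) / (2 * (k : ℝ))))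
    Filter.atTop ≤ ENNReal.ofReal (1 / γ)

/-- The coefficients of the radial function: `α ↦ r^{|α|} a_α`. -/
def scaleCoef {n : ℕ} (r : ℝ) (a : Word n → ℂ) : Word n → ℂ :=
  fun α => ((r : ℂ) ^ wordLen α) * a α

/-- Positivity of the free pluriharmonic function with coefficients `(a, b)` on the
noncommutative ball of radius `γ` of every complex Hilbert space. -/
def posPH {n : ℕ} (γ : ℝ) (a b : Word n → ℂ) : Prop :=
  ∀ (K : Type) [NormedAddCommGroup K] [InnerProductSpace ℂ K] [CompleteSpace K],
    ∀ X : Fin n → K →L[ℂ] K, inBall γ X → (phOp a b X).IsPositive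


/-- the l2 norm of the degree-k coefficients -/
def coefVec {n : ℕ} (a : Word n → ℂ) (k : ℕ) : EuclideanSpace ℂ (Fin k → Fin n) :=
  WithLp.toLp 2 (fun f => a (word f))

lemma coefVec_sub {n : ℕ} (a b : Word n → ℂ) (k : ℕ) :
    coefVec (a - b) k = coefVec a k - coefVec b k := by
  ext f; simp [coefVec]

lemma coefVec_norm_sq {n : ℕ} (a : Word n → ℂ) (k : ℕ) :
    ‖coefVec a k‖ ^ 2 = ∑ f : Fin k → Fin n, ‖a (word f)‖ ^ 2 := by
  rw [EuclideanSpace.norm_sq_eq]; simp [coefVec]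

lemma word_cons {n k : ℕ} (i : Fin n) (f : Fin k → Fin n) :
    (word (Fin.cons i f : Fin (k+1) → Fin n)) = FreeMonoid.of i * word f := by
  simp [word, List.ofFn_succ]

lemma wordProd_cons {n k : ℕ} {K : Type} [NormedAddCommGroup K] [InnerProductSpace ℂ K]
    (X : Fin n → K →L[ℂ] K) (i : Fin n) (f : Fin k → Fin n) :
    wordProd X (word (Fin.cons i f : Fin (k+1) → Fin n)) = X i * wordProd X (word f) := by
  simp [wordProd, word]

lemma sum_adj_le {n : ℕ} {K : Type} [NormedAddCommGroup K] [InnerProductSpace ℂ K]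
    [CompleteSpace K] (r : ℝ) (X : Fin n → K →L[ℂ] K) (hX : inClosedBall r X) (k : ℕ) (y : K) :
    ∑ f : Fin k → Fin n, ‖adjoint (wordProd X (word f)) y‖ ^ 2 ≤ (r ^ k) ^ 2 * ‖y‖ ^ 2 := by
  have h1 : ∀ y : K, ∑ i, ‖adjoint (X i) y‖ ^ 2 ≤ r ^ 2 * ‖y‖ ^ 2 := by
    intro y
    have : (∑ i, ‖adjoint (X i) y‖ ^ 2 : ℝ) =
        RCLike.re (inner ℂ ((∑ i, X i * adjoint (X i)) y) y) := by
      simp only [_root_.sum_apply, sum_inner, map_sum]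
      refine Finset.sum_congr rfl fun i _ => ?_
      rw [mul_apply_eq_comp, ← ContinuousLinearMap.adjoint_inner_right,
        inner_self_eq_norm_sq]
    rw [this]
    calc _ ≤ ‖inner ℂ ((∑ i, X i * adjoint (X i)) y) y‖ := RCLike.re_le_norm _
      _ ≤ ‖(∑ i, X i * adjoint (X i)) y‖ * ‖y‖ := norm_inner_le_norm _ _
      _ ≤ (‖∑ i, X i * adjoint (X i)‖ * ‖y‖) * ‖y‖ := by
          gcongr; exact ContinuousLinearMap.le_opNorm _ _
      _ ≤ (r ^ 2 * ‖y‖) * ‖y‖ := by gcongr; exact hX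
      _ = _ := by ring
  induction k generalizing y with
  | zero =>
    have : adjoint (1 : K →L[ℂ] K) = 1 := by
      rw [← ContinuousLinearMap.star_eq_adjoint, star_one]
    simp [wordProd, word, this]
  | succ k ih =>
    rw [← (Fin.consEquiv (fun _ => Fin n)).sum_comp, Fintype.sum_prod_type]
    calc _ = ∑ i, ∑ f : Fin k → Fin n,
          ‖adjoint (wordProd X (word f)) (adjoint (X i) y)‖ ^ 2 := by
          refine Finset.sum_congr rfl fun i _ => Finset.sum_congr rfl fun f _ => ?_
          simp only [Fin.consEquiv, Equiv.coe_fn_mk]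
          rw [wordProd_cons, ← ContinuousLinearMap.star_eq_adjoint, star_mul]
          rfl
      _ ≤ ∑ i, (r ^ k) ^ 2 * ‖adjoint (X i) y‖ ^ 2 := Finset.sum_le_sum fun i _ => ih _
      _ = (r ^ k) ^ 2 * ∑ i, ‖adjoint (X i) y‖ ^ 2 := by rw [Finset.mul_sum]
      _ ≤ (r ^ k) ^ 2 * (r ^ 2 * ‖y‖ ^ 2) := by gcongr; exact h1 y
      _ = _ := by ring

lemma truncSumAdj_norm_le {n : ℕ} {K : Type} [NormedAddCommGroup K] [InnerProductSpace ℂ K]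
    [CompleteSpace K] (r : ℝ) (hr : 0 ≤ r) (X : Fin n → K →L[ℂ] K) (hX : inClosedBall r X)
    (b : Word n → ℂ) (k : ℕ) :
    ‖truncSumAdj b X k‖ ≤ ‖coefVec b k‖ * r ^ k := by
  refine ContinuousLinearMap.opNorm_le_bound _ (by positivity) fun y => ?_
  rw [truncSumAdj, _root_.sum_apply]
  calc _ ≤ ∑ f : Fin k → Fin n, ‖b (word f)‖ * ‖adjoint (wordProd X (word f)) y‖ := by
        refine (norm_sum_le _ _).trans (le_of_eq ?_)
        refine Finset.sum_congr rfl fun f _ => ?_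
        rw [_root_.smul_apply, norm_smul]
    _ ≤ √(∑ f : Fin k → Fin n, ‖b (word f)‖ ^ 2) *
          √(∑ f : Fin k → Fin n, ‖adjoint (wordProd X (word f)) y‖ ^ 2) :=
        Real.sum_mul_le_sqrt_mul_sqrt _ _ _
    _ ≤ ‖coefVec b k‖ * (r ^ k * ‖y‖) := by
        gcongr
        · rw [← coefVec_norm_sq, Real.sqrt_sq (norm_nonneg _)]
        · refine Real.sqrt_le_iff.2 ⟨by positivity, ?_⟩
          rw [mul_pow]; exact sum_adj_le r X hX k y
    _ = _ := by ring

lemma truncSum_norm_le {n : ℕ} {K : Type} [NormedAddCommGroup K] [InnerProductSpace ℂ K]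
    [CompleteSpace K] (r : ℝ) (hr : 0 ≤ r) (X : Fin n → K →L[ℂ] K) (hX : inClosedBall r X)
    (a : Word n → ℂ) (k : ℕ) :
    ‖truncSum a X k‖ ≤ ‖coefVec a k‖ * r ^ k := by
  have h : truncSum a X k = adjoint (truncSumAdj (fun w => star (a w)) X k) := by
    rw [← ContinuousLinearMap.star_eq_adjoint]
    simp [truncSum, truncSumAdj, ← ContinuousLinearMap.star_eq_adjoint]
  have h2 : ‖coefVec (fun w => star (a w)) k‖ = ‖coefVec a k‖ := by
    rw [← sq_eq_sq₀ (norm_nonneg _) (norm_nonneg _), coefVec_norm_sq, coefVec_norm_sq]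
    simp
  rw [h, LinearIsometryEquiv.norm_map, ← h2]
  exact truncSumAdj_norm_le r hr X hX _ k

lemma radCond_bound {n : ℕ} {γ : ℝ} {a : Word n → ℂ} (hγ : 0 < γ)
    (h : radCond γ a) {ρ : ℝ} (h0 : 0 < ρ) (h1 : ρ < γ) :
    ∃ C : ℝ, 0 ≤ C ∧ ∀ k, ‖coefVec a k‖ * ρ ^ k ≤ C := by
  have hlt : ENNReal.ofReal (1 / γ) < ENNReal.ofReal (1 / ρ) := by
    rw [ENNReal.ofReal_lt_ofReal_iff (by positivity)]
    exact one_div_lt_one_div_of_lt h0 h1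
  have := eventually_lt_of_limsup_lt (lt_of_le_of_lt h hlt)
  obtain ⟨N, hN⟩ := eventually_atTop.1 this
  have key : ∀ k, N ≤ k → 1 ≤ k → ‖coefVec a k‖ * ρ ^ k ≤ 1 := by
    intro k hk hk1
    have h2 := hN k hk
    have e : (∑ f : Fin k → Fin n, (‖a (word f)‖₊ : ℝ≥0∞) ^ 2) =
        ENNReal.ofReal (‖coefVec a k‖ ^ 2) := by
      rw [coefVec_norm_sq, ENNReal.ofReal_sum_of_nonneg (fun _ _ => by positivity)]
      refine Finset.sum_congr rfl fun f _ => ?_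
      rw [ENNReal.ofReal_pow (norm_nonneg _), ofReal_norm]; rfl
    rw [e, ENNReal.ofReal_rpow_of_nonneg (by positivity) (by positivity),
      ENNReal.ofReal_lt_ofReal_iff (by positivity)] at h2
    have e2 : (‖coefVec a k‖ ^ 2) ^ ((1:ℝ) / (2 * (k:ℝ))) = ‖coefVec a k‖ ^ ((k:ℝ)⁻¹) := by
      rw [← Real.rpow_natCast, ← Real.rpow_mul (norm_nonneg _)]
      congr 1; push_cast; field_simp
    rw [e2] at h2
    have h3 : ‖coefVec a k‖ ≤ (1 / ρ) ^ k := by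
      calc ‖coefVec a k‖ = (‖coefVec a k‖ ^ ((k:ℝ)⁻¹)) ^ k :=
            (Real.rpow_inv_natCast_pow (norm_nonneg _) (by omega)).symm
        _ ≤ _ := by gcongr
    calc _ ≤ (1 / ρ) ^ k * ρ ^ k := by gcongr
      _ = 1 := by rw [← mul_pow]; field_simp; simp
  refine ⟨1 + ∑ j ∈ Finset.range (N+1), ‖coefVec a j‖ * ρ ^ j, by positivity, fun k => ?_⟩
  by_cases hk : k < N + 1
  · have := Finset.single_le_sum (f := fun j => ‖coefVec a j‖ * ρ ^ j)
      (fun j _ => by positivity) (Finset.mem_range.2 hk)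
    linarith
  · have h4 := key k (by omega) (by omega)
    have : 0 ≤ ∑ j ∈ Finset.range (N+1), ‖coefVec a j‖ * ρ ^ j := by positivity
    linarith

lemma radCond_of_bound {n : ℕ} {γ : ℝ} {a : Word n → ℂ} (hγ : 0 < γ)
    (h : ∀ ρ : ℝ, 0 < ρ → ρ < γ → ∃ C : ℝ, 0 ≤ C ∧ ∀ k, ‖coefVec a (k+1)‖ * ρ ^ (k+1) ≤ C) :
    radCond γ a := by
  have main : ∀ ρ : ℝ, 0 < ρ → ρ < γ → Filter.limsup
    (fun k : ℕ =>
      (∑ f : Fin k → Fin n, (‖a (word f)‖₊ : ℝ≥0∞) ^ 2) ^ ((1 : ℝ) / (2 * (k : ℝ))))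
    Filter.atTop ≤ ENNReal.ofReal (1 / ρ) := by
    intro ρ h0 h1
    obtain ⟨C, hC0, hC⟩ := h ρ h0 h1
    have ht : Tendsto (fun k : ℕ => ENNReal.ofReal ((C + 1) ^ ((k:ℝ)⁻¹) * (1 / ρ))) atTop
        (nhds (ENNReal.ofReal (1 / ρ))) := by
      refine ENNReal.tendsto_ofReal ?_
      have : Tendsto (fun k : ℕ => (C + 1) ^ ((k:ℝ)⁻¹) * (1 / ρ)) atTop
          (nhds ((C + 1) ^ (0:ℝ) * (1 / ρ))) := by
        refine Tendsto.mul_const _ ?_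
        exact (tendsto_const_nhds).rpow tendsto_inv_atTop_nhds_zero_nat (Or.inl (by positivity))
      simpa using this
    rw [← ht.limsup_eq]
    refine limsup_le_limsup ?_
    filter_upwards [eventually_ge_atTop 1] with k hk
    have e : (∑ f : Fin k → Fin n, (‖a (word f)‖₊ : ℝ≥0∞) ^ 2) =
        ENNReal.ofReal (‖coefVec a k‖ ^ 2) := by
      rw [coefVec_norm_sq, ENNReal.ofReal_sum_of_nonneg (fun _ _ => by positivity)]
      refine Finset.sum_congr rfl fun f _ => ?_
      rw [ENNReal.ofReal_pow (norm_nonneg _), ofReal_norm]; rfl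
    rw [e, ENNReal.ofReal_rpow_of_nonneg (by positivity) (by positivity)]
    refine ENNReal.ofReal_le_ofReal ?_
    have e2 : (‖coefVec a k‖ ^ 2) ^ ((1:ℝ) / (2 * (k:ℝ))) = ‖coefVec a k‖ ^ ((k:ℝ)⁻¹) := by
      rw [← Real.rpow_natCast, ← Real.rpow_mul (norm_nonneg _)]
      congr 1; push_cast; field_simp
    rw [e2]
    obtain ⟨j, rfl⟩ : ∃ j, k = j + 1 := ⟨k - 1, by omega⟩
    have h5 : ‖coefVec a (j+1)‖ ≤ (C + 1) * (1 / ρ) ^ (j+1) := by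
      have := hC j
      rw [one_div, inv_pow, ← div_eq_mul_inv, le_div_iff₀ (by positivity)]
      linarith
    calc ‖coefVec a (j+1)‖ ^ (((j+1:ℕ):ℝ)⁻¹)
        ≤ ((C + 1) * (1 / ρ) ^ (j+1)) ^ (((j+1:ℕ):ℝ)⁻¹) := by gcongr
      _ = _ := by
        rw [Real.mul_rpow (by positivity) (by positivity),
          Real.pow_rpow_inv_natCast (by positivity) (by omega)]
  have ht : Tendsto (fun ρ : ℝ => ENNReal.ofReal (1 / ρ)) (nhdsWithin γ (Set.Iio γ))
      (nhds (ENNReal.ofReal (1 / γ))) := by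
    refine ENNReal.tendsto_ofReal ?_
    have : ContinuousAt (fun ρ : ℝ => 1 / ρ) γ := by fun_prop (disch := exact hγ.ne')
    exact this.tendsto.mono_left nhdsWithin_le_nhds
  refine ge_of_tendsto ht ?_
  filter_upwards [self_mem_nhdsWithin, mem_nhdsWithin_of_mem_nhds (lt_mem_nhds hγ)] with ρ h1 h0
  exact main ρ h0 h1

lemma word_succ_ne_one {n k : ℕ} (f : Fin (k+1) → Fin n) : word f ≠ 1 := by
  intro h
  have := congrArg (fun w => (FreeMonoid.toList w).length) h
  simp [word] at this

lemma exists_lim {n : ℕ} {γ : ℝ} (hγ : 0 < γ) (a : ℕ → Word n → ℂ) (z : ℂ)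
    (ha : radCond γ (a 0)) (t : ℕ → ℝ) (ht : Summable t) (ht0 : ∀ m, 0 ≤ t m)
    (h : ∀ m k, ‖coefVec (a (m+1) - a m) (k+1)‖ * γ ^ (k+1) ≤ t m) :
    ∃ a' : Word n → ℂ, a' 1 = z ∧ radCond γ a' ∧
      ∀ m k, ‖coefVec (a m - a') (k+1)‖ * γ ^ (k+1) ≤ ∑' j, t (m + j) := by
  classical
  have hd : ∀ k m, dist (coefVec (a m) (k+1)) (coefVec (a (m+1)) (k+1)) ≤
      t m * (γ ^ (k+1))⁻¹ := by
    intro k m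
    rw [dist_comm, dist_eq_norm, ← coefVec_sub, ← div_eq_mul_inv, le_div_iff₀ (by positivity)]
    exact h m k
  have hs : ∀ k, Summable (fun m => t m * (γ ^ (k+1))⁻¹) := fun k => ht.mul_right _
  have hc : ∀ k, ∃ v, Tendsto (fun m => coefVec (a m) (k+1)) atTop (nhds v) := fun k =>
    cauchySeq_tendsto_of_complete (cauchySeq_of_dist_le_of_summable _ (hd k) (hs k))
  choose v hv using hc
  let a' : Word n → ℂ := fun α => if α = 1 then z else limUnder atTop (fun m => a m α)
  have hva : ∀ k, coefVec a' (k+1) = v k := by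
    intro k
    ext f
    have h1 : Tendsto (fun m => a m (word f)) atTop (nhds (v k f)) := by
      have := ((EuclideanSpace.proj (𝕜 := ℂ) f).continuous.tendsto (v k)).comp (hv k)
      simpa [Function.comp_def, coefVec] using this
    simp only [coefVec, a', if_neg (word_succ_ne_one f)]
    exact h1.limUnder_eq
  have hb : ∀ m k, ‖coefVec (a m - a') (k+1)‖ * γ ^ (k+1) ≤ ∑' j, t (m + j) := by
    intro m k
    have := dist_le_tsum_of_dist_le_of_tendsto _ (hd k) (hs k) (hv k) m
    rw [coefVec_sub, hva, ← dist_eq_norm, ← le_div_iff₀ (by positivity), div_eq_mul_inv,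
      ← tsum_mul_right]
    exact this
  refine ⟨a', by simp [a'], ?_, hb⟩
  refine radCond_of_bound hγ fun ρ h0 h1 => ?_
  obtain ⟨C, hC0, hC⟩ := radCond_bound hγ ha h0 h1
  have hS : 0 ≤ ∑' j, t (0 + j) := tsum_nonneg fun j => ht0 _
  refine ⟨C + ∑' j, t (0 + j), by positivity, fun k => ?_⟩
  have h2 : ‖coefVec a' (k+1)‖ ≤ ‖coefVec (a 0) (k+1)‖ + ‖coefVec (a 0 - a') (k+1)‖ := by
    rw [coefVec_sub]
    have := norm_sub_le (coefVec (a 0) (k+1)) (coefVec (a 0) (k+1) - coefVec a' (k+1))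
    simpa using this
  calc _ ≤ (‖coefVec (a 0) (k+1)‖ + ‖coefVec (a 0 - a') (k+1)‖) * ρ ^ (k+1) := by gcongr
    _ = ‖coefVec (a 0) (k+1)‖ * ρ ^ (k+1) + ‖coefVec (a 0 - a') (k+1)‖ * ρ ^ (k+1) := by ring
    _ ≤ C + ‖coefVec (a 0 - a') (k+1)‖ * γ ^ (k+1) := by
        gcongr
        exact hC _
    _ ≤ _ := by gcongr; exact hb 0 k

lemma summable_bound {n : ℕ} {γ : ℝ} (hγ : 0 < γ) {a : Word n → ℂ} (ha : radCond γ a)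
    {r : ℝ} (hr : 0 ≤ r) (hrγ : r < γ) :
    Summable fun k => ‖coefVec a (k+1)‖ * r ^ (k+1) := by
  obtain ⟨ρ, h1, h2⟩ := exists_between hrγ
  have h0 : 0 < ρ := hr.trans_lt h1
  obtain ⟨C, hC0, hC⟩ := radCond_bound hγ ha h0 h2
  have hg : Summable fun k : ℕ => C * (r / ρ) ^ (k+1) :=
    ((summable_nat_add_iff 1).2 (summable_geometric_of_lt_one (by positivity)
      ((div_lt_one h0).2 h1))).mul_left C
  refine Summable.of_nonneg_of_le (fun k => by positivity) (fun k => ?_) hg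
  calc ‖coefVec a (k+1)‖ * r ^ (k+1) = (‖coefVec a (k+1)‖ * ρ ^ (k+1)) * (r / ρ) ^ (k+1) := by
        rw [div_pow]; field_simp
    _ ≤ _ := by gcongr; exact hC _

lemma phOp_sub_norm_le {n : ℕ} {K : Type} [NormedAddCommGroup K] [InnerProductSpace ℂ K]
    [CompleteSpace K] {γ : ℝ} (hγ : 0 < γ) {a a' b b' : Word n → ℂ}
    (ha : radCond γ a) (ha' : radCond γ a') (hb : radCond γ b) (hb' : radCond γ b')
    {δ : ℝ} (h1 : ‖a 1 - a' 1‖ ≤ δ)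
    (h2 : ∀ k, ‖coefVec (a - a') (k+1)‖ * γ ^ (k+1) ≤ δ)
    (h3 : ∀ k, ‖coefVec (b - b') (k+1)‖ * γ ^ (k+1) ≤ δ)
    {r : ℝ} (hr : 0 ≤ r) (hrγ : r < γ) (X : Fin n → K →L[ℂ] K) (hX : inClosedBall r X) :
    ‖phOp a b X - phOp a' b' X‖ ≤ δ * (1 + 2 * ∑' k : ℕ, (r / γ) ^ (k+1)) := by
  have sA : ∀ a : Word n → ℂ, radCond γ a → Summable fun k => truncSum a X (k+1) :=
    fun a ha => Summable.of_norm_bounded (summable_bound hγ ha hr hrγ)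
      fun k => truncSum_norm_le r hr X hX a (k+1)
  have sB : ∀ a : Word n → ℂ, radCond γ a → Summable fun k => truncSumAdj a X (k+1) :=
    fun a ha => Summable.of_norm_bounded (summable_bound hγ ha hr hrγ)
      fun k => truncSumAdj_norm_le r hr X hX a (k+1)
  have eA : (∑' k : ℕ, truncSum a X (k + 1)) - ∑' k : ℕ, truncSum a' X (k + 1) =
      ∑' k : ℕ, truncSum (a - a') X (k + 1) := by
    rw [← (sA a ha).tsum_sub (sA a' ha')]
    simp [truncSum, sub_smul, Finset.sum_sub_distrib]
  have eB : (∑' k : ℕ, truncSumAdj b X (k + 1)) - ∑' k : ℕ, truncSumAdj b' X (k + 1) =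
      ∑' k : ℕ, truncSumAdj (b - b') X (k + 1) := by
    rw [← (sB b hb).tsum_sub (sB b' hb')]
    simp [truncSumAdj, sub_smul, Finset.sum_sub_distrib]
  have hg : Summable fun k : ℕ => (r / γ) ^ (k+1) :=
    ((summable_nat_add_iff 1).2 (summable_geometric_of_lt_one (by positivity)
      ((div_lt_one hγ).2 hrγ)))
  have hb1 : ∀ c : Word n → ℂ, (∀ k, ‖coefVec c (k+1)‖ * γ ^ (k+1) ≤ δ) → ∀ k,
      ‖coefVec c (k+1)‖ * r ^ (k+1) ≤ δ * (r / γ) ^ (k+1) := by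
    intro c hc k
    calc ‖coefVec c (k+1)‖ * r ^ (k+1) = (‖coefVec c (k+1)‖ * γ ^ (k+1)) * (r / γ) ^ (k+1) := by
          rw [div_pow]; field_simp
      _ ≤ _ := by gcongr; exact hc _
  have nA : ‖∑' k : ℕ, truncSum (a - a') X (k + 1)‖ ≤ δ * ∑' k : ℕ, (r / γ) ^ (k+1) :=
    tsum_of_norm_bounded (hg.hasSum.mul_left δ)
      fun k => (truncSum_norm_le r hr X hX _ _).trans (hb1 _ h2 k)
  have nB : ‖∑' k : ℕ, truncSumAdj (b - b') X (k + 1)‖ ≤ δ * ∑' k : ℕ, (r / γ) ^ (k+1) :=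
    tsum_of_norm_bounded (hg.hasSum.mul_left δ)
      fun k => (truncSumAdj_norm_le r hr X hX _ _).trans (hb1 _ h3 k)
  have e : phOp a b X - phOp a' b' X = (∑' k : ℕ, truncSumAdj (b - b') X (k + 1)) +
      (a 1 - a' 1) • (1 : K →L[ℂ] K) + ∑' k : ℕ, truncSum (a - a') X (k + 1) := by
    rw [← eA, ← eB, phOp, phOp, sub_smul]; abel
  have n1 : ‖(a 1 - a' 1) • (1 : K →L[ℂ] K)‖ ≤ δ := by
    rw [norm_smul]
    have : ‖(1 : K →L[ℂ] K)‖ ≤ 1 := ContinuousLinearMap.norm_id_le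
    calc _ ≤ ‖a 1 - a' 1‖ * 1 := by gcongr
      _ ≤ δ := by simpa using h1
  rw [e]
  refine (norm_add₃_le).trans ?_
  linarith

/-- words of length at most `N` -/
abbrev WI (n N : ℕ) := {w : List (Fin n) // w.length ≤ N}

instance instFintypeWI (n N : ℕ) : Fintype (WI n N) :=
  (List.finite_length_le (Fin n) N).fintype

/-- matrix of left concatenation by `L` on words of length at most `N` -/
def shiftM (n N : ℕ) (L : List (Fin n)) : Matrix (WI n N) (WI n N) ℂ :=
  Matrix.of fun v w => if v.1 = L ++ w.1 then 1 else 0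

lemma shiftM_mul (n N : ℕ) (i : Fin n) (L : List (Fin n)) :
    shiftM n N [i] * shiftM n N L = shiftM n N (i :: L) := by
  ext v w
  simp only [shiftM, Matrix.mul_apply, Matrix.of_apply]
  by_cases h : v.1 = (i :: L) ++ w.1
  · rw [if_pos h]
    have hl : (L ++ w.1).length ≤ N := by
      have := v.2
      rw [h] at this
      simp at this ⊢
      omega
    rw [Finset.sum_eq_single ⟨L ++ w.1, hl⟩]
    · simp [h]
    · intro x _ hx
      have : x.1 ≠ L ++ w.1 := fun h' => hx (Subtype.ext h')
      simp [this]
    · simp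
  · rw [if_neg h]
    refine Finset.sum_eq_zero fun x _ => ?_
    by_cases h1 : x.1 = L ++ w.1
    · rw [h1]; simp at h; simp [h]
    · simp [h1]

lemma shiftM_row (n N : ℕ) :
    ∑ i, shiftM n N [i] * (shiftM n N [i]).conjTranspose =
      Matrix.diagonal (fun v : WI n N => if v.1 = [] then 0 else 1) := by
  ext v w
  rw [Matrix.sum_apply]
  simp only [shiftM, Matrix.mul_apply, Matrix.of_apply, Matrix.conjTranspose_apply]
  obtain ⟨v, hv⟩ := v
  cases v with
  | nil => simp [Matrix.diagonal_apply]
  | cons i0 v =>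
    rw [Finset.sum_eq_single i0]
    · rw [Finset.sum_eq_single ⟨v, by simp at hv; omega⟩]
      · simp [Matrix.diagonal_apply, Subtype.ext_iff, eq_comm]
      · intro x _ hx
        have : v ≠ x.1 := fun h' => hx (Subtype.ext h'.symm)
        simp [this]
      · simp
    · intro j _ hj
      refine Finset.sum_eq_zero fun x _ => ?_
      simp [hj.symm]
    · simp

/-- test tuple -/
def testX (n N : ℕ) (ρ : ℝ) (i : Fin n) :
    EuclideanSpace ℂ (WI n N) →L[ℂ] EuclideanSpace ℂ (WI n N) :=
  Matrix.toEuclideanCLM (n := WI n N) (𝕜 := ℂ) ((ρ : ℂ) • shiftM n N [i])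

open scoped Matrix.Norms.L2Operator in
lemma testX_ball (n N : ℕ) {ρ γ : ℝ} (h0 : 0 < ρ) (h1 : ρ < γ) : inBall γ (testX n N ρ) := by
  have e : ∑ i, testX n N ρ i * adjoint (testX n N ρ i) =
      Matrix.toEuclideanCLM (n := WI n N) (𝕜 := ℂ)
        (((ρ : ℂ) ^ 2) • Matrix.diagonal (fun v : WI n N => if v.1 = [] then (0:ℂ) else 1)) := by
    rw [← shiftM_row, Finset.smul_sum, map_sum]
    refine Finset.sum_congr rfl fun i _ => ?_
    rw [testX, ← ContinuousLinearMap.star_eq_adjoint, ← map_star, ← map_mul,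
      Matrix.star_eq_conjTranspose]
    congr 1
    have hst : star (ρ : ℂ) = ρ := by simp
    rw [Matrix.conjTranspose_smul, smul_mul_assoc, mul_smul_comm, smul_smul, hst, pow_two]
  rw [inBall, e, Matrix.l2_opNorm_toEuclideanCLM, norm_smul, Matrix.l2_opNorm_diagonal]
  have h2 : ‖(fun v : WI n N => if v.1 = [] then (0:ℂ) else 1)‖ ≤ 1 := by
    refine (pi_norm_le_iff_of_nonneg zero_le_one).2 fun v => ?_
    split_ifs <;> simp
  calc _ ≤ ‖(ρ : ℂ) ^ 2‖ * 1 := by gcongr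
    _ = ρ ^ 2 := by simp
    _ < γ ^ 2 := by gcongr

lemma testX_wordProd (n N : ℕ) (ρ : ℝ) {j : ℕ} (f : Fin j → Fin n) :
    wordProd (testX n N ρ) (word f) =
      Matrix.toEuclideanCLM (n := WI n N) (𝕜 := ℂ)
        (((ρ : ℂ) ^ j) • shiftM n N (List.ofFn f)) := by
  have key : ∀ L : List (Fin n), (L.map (testX n N ρ)).prod =
      Matrix.toEuclideanCLM (n := WI n N) (𝕜 := ℂ)
        (((ρ : ℂ) ^ L.length) • shiftM n N L) := by
    intro L
    induction L with
    | nil =>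
      have : shiftM n N [] = 1 := by
        ext v w; simp [shiftM, Matrix.one_apply, Subtype.ext_iff]
      simp [this]
    | cons i L ih =>
      rw [List.map_cons, List.prod_cons, ih, testX, ← map_mul, ← shiftM_mul n N i L]
      congr 1
      rw [smul_mul_assoc, mul_smul_comm, smul_smul, List.length_cons, pow_succ']
  simpa [wordProd, word] using key (List.ofFn f)

/-- degree-j part -/
def matA (n N : ℕ) (ρ : ℝ) (c : Word n → ℂ) (j : ℕ) : Matrix (WI n N) (WI n N) ℂ :=
  ∑ f : Fin j → Fin n, (c (word f) * (ρ : ℂ) ^ j) • shiftM n N (List.ofFn f)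

/-- degree-j adjoint part -/
def matB (n N : ℕ) (ρ : ℝ) (d : Word n → ℂ) (j : ℕ) : Matrix (WI n N) (WI n N) ℂ :=
  ∑ f : Fin j → Fin n, (d (word f) * (ρ : ℂ) ^ j) • (shiftM n N (List.ofFn f)).conjTranspose

lemma matA_apply (n N : ℕ) (ρ : ℝ) (c : Word n → ℂ) (j : ℕ) (v w : WI n N) :
    matA n N ρ c j v w = ∑ f : Fin j → Fin n,
      if v.1 = List.ofFn f ++ w.1 then c (word f) * (ρ : ℂ) ^ j else 0 := by
  simp [matA, Matrix.sum_apply, shiftM]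

lemma matB_apply (n N : ℕ) (ρ : ℝ) (c : Word n → ℂ) (j : ℕ) (v w : WI n N) :
    matB n N ρ c j v w = ∑ f : Fin j → Fin n,
      if w.1 = List.ofFn f ++ v.1 then c (word f) * (ρ : ℂ) ^ j else 0 := by
  simp only [matB, Matrix.sum_apply, shiftM, Matrix.smul_apply, Matrix.conjTranspose_apply,
    Matrix.of_apply]
  refine Finset.sum_congr rfl fun f _ => ?_
  split_ifs <;> simp

lemma matA_eq_zero (n N : ℕ) (ρ : ℝ) (c : Word n → ℂ) (j : ℕ) (v w : WI n N)
    (h : v.1.length ≠ j + w.1.length) : matA n N ρ c j v w = 0 := by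
  rw [matA_apply]
  refine Finset.sum_eq_zero fun f _ => if_neg fun h' => h ?_
  rw [h']; simp

lemma matB_eq_zero (n N : ℕ) (ρ : ℝ) (c : Word n → ℂ) (j : ℕ) (v w : WI n N)
    (h : w.1.length ≠ j + v.1.length) : matB n N ρ c j v w = 0 := by
  rw [matB_apply]
  refine Finset.sum_eq_zero fun f _ => if_neg fun h' => h ?_
  rw [h']; simp

lemma testX_truncSum (n N : ℕ) (ρ : ℝ) (c : Word n → ℂ) (j : ℕ) :
    truncSum c (testX n N ρ) j = Matrix.toEuclideanCLM (n := WI n N) (𝕜 := ℂ)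
      (matA n N ρ c j) := by
  rw [truncSum, matA, map_sum]
  refine Finset.sum_congr rfl fun f _ => ?_
  rw [testX_wordProd, ← map_smul, smul_smul]

lemma testX_truncSumAdj (n N : ℕ) (ρ : ℝ) (c : Word n → ℂ) (j : ℕ) :
    truncSumAdj c (testX n N ρ) j = Matrix.toEuclideanCLM (n := WI n N) (𝕜 := ℂ)
      (matB n N ρ c j) := by
  rw [truncSumAdj, matB, map_sum]
  refine Finset.sum_congr rfl fun f _ => ?_
  rw [testX_wordProd, ← ContinuousLinearMap.star_eq_adjoint, ← map_star, ← map_smul,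
    Matrix.star_eq_conjTranspose, Matrix.conjTranspose_smul, smul_smul]
  simp

/-- the full matrix -/
def matM (n N : ℕ) (ρ : ℝ) (c d : Word n → ℂ) : Matrix (WI n N) (WI n N) ℂ :=
  (∑ j ∈ Finset.range N, matB n N ρ d (j+1)) + c 1 • (1 : Matrix (WI n N) (WI n N) ℂ)
    + ∑ j ∈ Finset.range N, matA n N ρ c (j+1)

lemma testX_phOp (n N : ℕ) (ρ : ℝ) (c d : Word n → ℂ) :
    phOp c d (testX n N ρ) = Matrix.toEuclideanCLM (n := WI n N) (𝕜 := ℂ)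
      (matM n N ρ c d) := by
  have hA : ∀ j ∉ Finset.range N, matA n N ρ c (j+1) = 0 := by
    intro j hj
    ext v w
    have := v.2
    simp at hj
    exact matA_eq_zero _ _ _ _ _ _ _ (by omega)
  have hB : ∀ j ∉ Finset.range N, matB n N ρ d (j+1) = 0 := by
    intro j hj
    ext v w
    have := w.2
    simp at hj
    exact matB_eq_zero _ _ _ _ _ _ _ (by omega)
  rw [phOp, matM, map_add, map_add, map_sum, map_sum, map_smul, map_one]
  simp only [testX_truncSum, testX_truncSumAdj]
  rw [tsum_eq_sum (s := Finset.range N) (fun j hj => by rw [hB j hj, map_zero]),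
    tsum_eq_sum (s := Finset.range N) (fun j hj => by rw [hA j hj, map_zero])]

lemma matM_psd {n : ℕ} (N : ℕ) {γ ρ : ℝ} {c d : Word n → ℂ} (h : posPH γ c d)
    (h0 : 0 < ρ) (h1 : ρ < γ) : (matM n N ρ c d).PosSemidef := by
  have := h _ (testX n N ρ) (testX_ball n N h0 h1)
  rw [testX_phOp] at this
  exact Matrix.isPositive_toEuclideanLin_iff.1 this.toLinearMap

/-- index map -/
def gidx (n k : ℕ) : Unit ⊕ (Fin (k+1) → Fin n) → WI n (k+1) :=
  Sum.elim (fun _ => ⟨[], by simp⟩) (fun f => ⟨List.ofFn f, by simp⟩)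

lemma matM_sub (n k : ℕ) (ρ : ℝ) (c d : Word n → ℂ) :
    (matM n (k+1) ρ c d).submatrix (gidx n k) (gidx n k) =
      Matrix.fromBlocks (Matrix.of fun _ _ => c 1)
        (Matrix.of fun _ f => d (word f) * (ρ : ℂ) ^ (k+1))
        (Matrix.of fun f _ => c (word f) * (ρ : ℂ) ^ (k+1))
        (c 1 • (1 : Matrix (Fin (k+1) → Fin n) (Fin (k+1) → Fin n) ℂ)) := by
  ext x y
  simp only [Matrix.submatrix_apply, matM, Matrix.add_apply, Matrix.sum_apply]
  rcases x with x | x <;> rcases y with y | y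
  · rw [Finset.sum_eq_zero fun j _ => matB_eq_zero _ _ _ _ _ _ _ (by simp [gidx]),
      Finset.sum_eq_zero fun j _ => matA_eq_zero _ _ _ _ _ _ _ (by simp [gidx])]
    simp [gidx]
  · rw [Finset.sum_eq_single k,
      Finset.sum_eq_zero fun j _ => matA_eq_zero _ _ _ _ _ _ _ (by simp [gidx]), matB_apply]
    · have hne : gidx n k (Sum.inl x) ≠ gidx n k (Sum.inr y) := by
        intro h
        have := congrArg (fun w => w.1.length) h
        simp [gidx] at this
      rw [Matrix.smul_apply, Matrix.one_apply, if_neg hne]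
      simp [gidx, List.ofFn_inj, -List.ofFn_succ]
    · intro j _ hj
      exact matB_eq_zero _ _ _ _ _ _ _ (by simp [gidx]; omega)
    · simp
  · rw [Finset.sum_eq_zero fun j _ => matB_eq_zero _ _ _ _ _ _ _ (by simp [gidx]),
      Finset.sum_eq_single k, matA_apply]
    · have hne : gidx n k (Sum.inr x) ≠ gidx n k (Sum.inl y) := by
        intro h
        have := congrArg (fun w => w.1.length) h
        simp [gidx] at this
      rw [Matrix.smul_apply, Matrix.one_apply, if_neg hne]
      simp [gidx, List.ofFn_inj, -List.ofFn_succ]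
    · intro j _ hj
      exact matA_eq_zero _ _ _ _ _ _ _ (by simp [gidx]; omega)
    · simp
  · rw [Finset.sum_eq_zero fun j _ => matB_eq_zero _ _ _ _ _ _ _ (by simp [gidx]),
      Finset.sum_eq_zero fun j _ => matA_eq_zero _ _ _ _ _ _ _ (by simp [gidx])]
    simp [gidx, Matrix.one_apply, Subtype.ext_iff, List.ofFn_inj, -List.ofFn_succ]

lemma pos_coef_aux {n : ℕ} {γ ρ : ℝ} {c d : Word n → ℂ} (h : posPH γ c d)
    (h0 : 0 < ρ) (h1 : ρ < γ) (k : ℕ) :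
    (c 1 = ((c 1).re : ℂ) ∧ 0 ≤ (c 1).re) ∧ ‖coefVec c (k+1)‖ * ρ ^ (k+1) ≤ (c 1).re ∧
      ‖coefVec d (k+1)‖ = ‖coefVec c (k+1)‖ := by
  have hp := (matM_psd (k+1) h h0 h1).submatrix (gidx n k)
  rw [matM_sub] at hp
  have hc1 : 0 ≤ c 1 := by
    simpa using hp.diag_nonneg (i := Sum.inl ())
  obtain ⟨hre, him⟩ := Complex.nonneg_iff.1 hc1
  have hreal : c 1 = ((c 1).re : ℂ) := Complex.ext (by simp) (by simp [← him])
  have hdc : ∀ f : Fin (k+1) → Fin n, d (word f) = star (c (word f)) := by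
    intro f
    have := hp.1.apply (Sum.inl ()) (Sum.inr f)
    simp at this
    exact this.resolve_right h0.ne' |>.symm
  refine ⟨⟨hreal, hre⟩, ?_, ?_⟩
  · set s : ℝ := ‖coefVec c (k+1)‖ * ρ ^ (k+1) with hs
    have hs0 : 0 ≤ s := by positivity
    have hs2 : (s : ℂ) ^ 2 = ∑ f : Fin (k+1) → Fin n,
        star (c (word f) * (ρ : ℂ) ^ (k+1)) * (c (word f) * (ρ : ℂ) ^ (k+1)) := by
      rw [← Complex.ofReal_pow, hs, mul_pow, coefVec_norm_sq, Finset.sum_mul]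
      push_cast
      refine Finset.sum_congr rfl fun f _ => ?_
      rw [← Complex.conj_mul']
      simp
      ring
    have hq := hp.dotProduct_mulVec_nonneg
      (Sum.elim (fun _ => (s : ℂ)) (fun f => -(c (word f) * (ρ : ℂ) ^ (k+1))))
    have hq2 : 0 ≤ (c 1).re * s ^ 2 - 2 * s * s ^ 2 + (c 1).re * s ^ 2 := by
      have : star (Sum.elim (fun _ => (s : ℂ)) (fun f => -(c (word f) * (ρ : ℂ) ^ (k+1)))) ⬝ᵥ
        (Matrix.fromBlocks (Matrix.of fun (_ : Unit) (_ : Unit) => c 1)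
        (Matrix.of fun _ f => d (word f) * (ρ : ℂ) ^ (k+1))
        (Matrix.of fun f _ => c (word f) * (ρ : ℂ) ^ (k+1))
        (c 1 • (1 : Matrix (Fin (k+1) → Fin n) (Fin (k+1) → Fin n) ℂ))).mulVec
        (Sum.elim (fun _ => (s : ℂ)) (fun f => -(c (word f) * (ρ : ℂ) ^ (k+1)))) =
        (((c 1).re * s ^ 2 - 2 * s * s ^ 2 + (c 1).re * s ^ 2 : ℝ) : ℂ) := by
        rw [Matrix.fromBlocks_mulVec]
        simp only [dotProduct, Fintype.sum_sum_type, Pi.star_apply, Sum.elim_inl, Sum.elim_inr,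
          Finset.univ_unique, Finset.sum_singleton, Matrix.mulVec, Matrix.of_apply,
          Pi.add_apply, Function.comp]
        push_cast
        rw [← hreal]
        have hz : ∀ f : Fin (k+1) → Fin n, ∑ x : Fin (k+1) → Fin n,
            (c 1 • (1 : Matrix (Fin (k+1) → Fin n) (Fin (k+1) → Fin n) ℂ)) f x *
              -(c (word x) * (ρ : ℂ) ^ (k+1)) = - (c 1 * (c (word f) * (ρ : ℂ) ^ (k+1))) := by
          intro f
          simp [Matrix.one_apply]
        simp only [hz]
        have e1 : ∑ f : Fin (k+1) → Fin n, d (word f) * (ρ : ℂ) ^ (k+1) *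
            -(c (word f) * (ρ : ℂ) ^ (k+1)) = - (s : ℂ) ^ 2 := by
          rw [hs2, ← Finset.sum_neg_distrib]
          refine Finset.sum_congr rfl fun f _ => ?_
          rw [hdc]; simp
        have e2 : ∑ f : Fin (k+1) → Fin n, star (-(c (word f) * (ρ : ℂ) ^ (k+1))) *
            (c (word f) * (ρ : ℂ) ^ (k+1) * s + -(c 1 * (c (word f) * (ρ : ℂ) ^ (k+1)))) =
            (c 1 - s) * (s : ℂ) ^ 2 := by
          rw [hs2, Finset.mul_sum]
          refine Finset.sum_congr rfl fun f _ => ?_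
          rw [star_neg]; ring
        rw [e1, e2]
        simp
        ring
      rw [this] at hq
      exact_mod_cast hq
    by_contra hlt
    push Not at hlt
    have : 0 < s := hre.trans_lt hlt
    nlinarith [mul_pos (pow_pos this 2) (sub_pos.2 hlt)]
  · rw [← sq_eq_sq₀ (norm_nonneg _) (norm_nonneg _), coefVec_norm_sq, coefVec_norm_sq]
    refine Finset.sum_congr rfl fun f _ => ?_
    rw [hdc, norm_star]

lemma pos_coef {n : ℕ} {γ : ℝ} (hγ : 0 < γ) {c d : Word n → ℂ} (h : posPH γ c d) :
    (c 1 = ((c 1).re : ℂ) ∧ 0 ≤ (c 1).re) ∧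
    (∀ k, ‖coefVec c (k+1)‖ * γ ^ (k+1) ≤ (c 1).re) ∧
    (∀ k, ‖coefVec d (k+1)‖ * γ ^ (k+1) ≤ (c 1).re) := by
  have hh : 0 < γ / 2 := by positivity
  have hA : ∀ k, ‖coefVec c (k+1)‖ * γ ^ (k+1) ≤ (c 1).re := by
    intro k
    have ht : Tendsto (fun ρ : ℝ => ‖coefVec c (k+1)‖ * ρ ^ (k+1)) (nhdsWithin γ (Set.Iio γ))
        (nhds (‖coefVec c (k+1)‖ * γ ^ (k+1))) := by
      have : Continuous (fun ρ : ℝ => ‖coefVec c (k+1)‖ * ρ ^ (k+1)) := by fun_prop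
      exact (this.tendsto γ).mono_left nhdsWithin_le_nhds
    refine le_of_tendsto ht ?_
    filter_upwards [self_mem_nhdsWithin, mem_nhdsWithin_of_mem_nhds (lt_mem_nhds hγ)] with ρ h1 h0
    exact (pos_coef_aux h h0 h1 k).2.1
  refine ⟨(pos_coef_aux h hh (half_lt_self hγ) 0).1, hA, fun k => ?_⟩
  rw [(pos_coef_aux h hh (half_lt_self hγ) k).2.2]
  exact hA k

theorem stmt_5 (n : ℕ) (hn : 1 ≤ n) (γ : ℝ) (hγ : 0 < γ)
    (a b : ℕ → Word n → ℂ)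
    (ha : ∀ m : ℕ, radCond γ (a m)) (hb : ∀ m : ℕ, radCond γ (b m))
    (hmono : ∀ m : ℕ, posPH γ (a (m + 1) - a m) (b (m + 1) - b m))
    (hbdd : ∃ C : ℝ, ∀ m : ℕ, ‖a m 1‖ ≤ C) :
    ∃ a' b' : Word n → ℂ, radCond γ a' ∧ radCond γ b' ∧
      ∀ (K : Type) [NormedAddCommGroup K] [InnerProductSpace ℂ K] [CompleteSpace K],
        ∀ r : ℝ, 0 ≤ r → r < γ → ∀ ε : ℝ, 0 < ε →
          ∃ M : ℕ, ∀ m : ℕ, M ≤ m → ∀ X : Fin n → K →L[ℂ] K, inClosedBall r X →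
            ‖phOp (a m) (b m) X - phOp a' b' X‖ < ε := by
  obtain ⟨C, hC⟩ := hbdd
  let t : ℕ → ℝ := fun m => ((a (m+1) - a m) 1).re
  have hp := fun m => pos_coef hγ (hmono m)
  have ht0 : ∀ m, 0 ≤ t m := fun m => (hp m).1.2
  have ht : Summable t := by
    refine summable_of_sum_range_le ht0 (c := 2 * C) fun m => ?_
    have e : ∑ i ∈ Finset.range m, t i = (a m 1).re - (a 0 1).re := by
      rw [← Finset.sum_range_sub (fun i => (a i 1).re)]
      simp [t]
    rw [e]
    have h1 := (Complex.abs_re_le_norm (a m 1)).trans (hC m)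
    have h2 := (Complex.abs_re_le_norm (a 0 1)).trans (hC 0)
    rw [abs_le] at h1 h2
    linarith [h1.2, h2.1]
  have hd : ∀ m, dist (a m 1) (a (m+1) 1) ≤ t m := by
    intro m
    have h1 := (hp m).1.1
    rw [dist_comm, dist_eq_norm, ← Pi.sub_apply, h1, Complex.norm_real, Real.norm_of_nonneg (ht0 m)]
  obtain ⟨z, hz⟩ := cauchySeq_tendsto_of_complete (cauchySeq_of_dist_le_of_summable _ hd ht)
  have hz' := dist_le_tsum_of_dist_le_of_tendsto _ hd ht hz
  obtain ⟨a', ha1, ha', hA⟩ := exists_lim hγ a z (ha 0) t ht ht0 fun m => (hp m).2.1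
  obtain ⟨b', hb1, hb', hB⟩ := exists_lim hγ b z (hb 0) t ht ht0 fun m => (hp m).2.2
  refine ⟨a', b', ha', hb', ?_⟩
  intro K _ _ _ r hr hrγ ε hε
  have hlim : Tendsto (fun m => (∑' j, t (m + j)) * (1 + 2 * ∑' k : ℕ, (r / γ) ^ (k+1)))
      atTop (nhds 0) := by
    have : Tendsto (fun m => ∑' j, t (m + j)) atTop (nhds 0) := by
      simpa [add_comm] using tendsto_sum_nat_add t
    simpa using this.mul_const (1 + 2 * ∑' k : ℕ, (r / γ) ^ (k+1))
  obtain ⟨M, hM⟩ := eventually_atTop.1 (hlim.eventually_lt_const hε)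
  refine ⟨M, fun m hm X hX => lt_of_le_of_lt ?_ (hM m hm)⟩
  refine phOp_sub_norm_le hγ (ha m) ha' (hb m) hb' ?_ (hA m) (hB m) hr hrγ X hX
  rw [ha1, ← dist_eq_norm]
  exact hz' m

end
end

section
/- Let u be the free pluriharmonic function with scalar coefficients (a, b) on the unit ball (γ = 1), and suppose u is bounded: there exists M ≥ 0 such that ‖u_K(X)‖ ≤ M for every complex Hilbert space K and every X ∈ [B(K)ⁿ]₁. Let H be a complex Hilbert space and let X = (X₁,…,Xₙ) ∈ [B(H)ⁿ]₁⁻ be a pure n-tuple, i.e., Σ_{|α|=k} X_α X_α* h → 0 as k → ∞ for every h ∈ H. Then there exists L ∈ B(H) such that for every h ∈ H, u_H(rX₁,…,rXₙ) h → L h in H as r → 1⁻ (i.e., the strong operator limit of u_H(rX) as r → 1⁻ exists). -/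
open scoped ENNReal ComplexOrder
open Filter ContinuousLinearMap

noncomputable section

section Helpers

open scoped Topology

/-- Abel-type limit for orthogonal series. -/
lemma orth_abel {E : Type} [NormedAddCommGroup E] [InnerProductSpace ℂ E] [CompleteSpace E]
    (w : ℕ → E) (hw : ∀ i j, i ≠ j → inner ℂ (w i) (w j) = 0)
    (s : ℝ → E) (C : ℝ)
    (hs : ∀ r ∈ Set.Ico (0:ℝ) 1, HasSum (fun k : ℕ => ((r:ℂ) ^ (k+1)) • w k) (s r))
    (hC : ∀ r ∈ Set.Ico (0:ℝ) 1, ‖s r‖ ≤ C) :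
    ∃ W : E, Tendsto s (𝓝[Set.Ico (0:ℝ) 1] 1) (𝓝 W) := by
  have hfin : ∀ (c : ℕ → ℂ) (F : Finset ℕ),
      ‖∑ k ∈ F, c k • w k‖ ^ 2 = ∑ k ∈ F, ‖c k‖ ^ 2 * ‖w k‖ ^ 2 := by
    intro c F
    have h2 : ∀ x : E, ((‖x‖ ^ 2 : ℝ) : ℂ) = inner ℂ x x := by
      intro x; rw [inner_self_eq_norm_sq_to_K]; norm_cast
    have : ((‖∑ k ∈ F, c k • w k‖ ^ 2 : ℝ) : ℂ) = ((∑ k ∈ F, ‖c k‖ ^ 2 * ‖w k‖ ^ 2 : ℝ) : ℂ) := by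
      rw [h2, sum_inner, Complex.ofReal_sum]
      refine Finset.sum_congr rfl fun i hi => ?_
      rw [inner_sum, Finset.sum_eq_single i]
      · rw [← h2, norm_smul, mul_pow]
      · intro j _ hj
        rw [inner_smul_left, inner_smul_right, hw i j hj.symm]; simp
      · intro h; exact absurd hi h
    exact_mod_cast this
  have hsq : ∀ (c : ℕ → ℂ) (v : E), HasSum (fun k => c k • w k) v →
      HasSum (fun k => ‖c k‖ ^ 2 * ‖w k‖ ^ 2) (‖v‖ ^ 2) := by
    intro c v h
    have h1 : Tendsto (fun F : Finset ℕ => ‖∑ k ∈ F, c k • w k‖ ^ 2) atTop (𝓝 (‖v‖ ^ 2)) :=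
      (Filter.Tendsto.norm h).pow 2
    simp only [hfin] at h1
    exact h1
  haveI hne : (𝓝[Set.Ico (0:ℝ) 1] 1).NeBot := by
    rw [← mem_closure_iff_nhdsWithin_neBot, closure_Ico (by norm_num)]
    simp
  have hmem : ∀ᶠ r in 𝓝[Set.Ico (0:ℝ) 1] 1, r ∈ Set.Ico (0:ℝ) 1 := self_mem_nhdsWithin
  have hsumm : Summable (fun k => ‖w k‖ ^ 2) := by
    refine summable_of_sum_le (c := C ^ 2) (fun _ => by positivity) fun F => ?_
    have hlim : Tendsto (fun r : ℝ => ∑ k ∈ F, ‖((r:ℂ) ^ (k+1))‖ ^ 2 * ‖w k‖ ^ 2)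
        (𝓝[Set.Ico (0:ℝ) 1] 1) (𝓝 (∑ k ∈ F, ‖(((1:ℝ):ℂ) ^ (k+1))‖ ^ 2 * ‖w k‖ ^ 2)) := by
      refine Tendsto.mono_left (Continuous.tendsto ?_ _) nhdsWithin_le_nhds
      fun_prop
    have := le_of_tendsto hlim (b := C ^ 2) (hmem.mono fun r hr => ?_)
    · simpa using this
    · refine (sum_le_hasSum F (fun _ _ => by positivity) (hsq _ _ (hs r hr))).trans ?_
      exact pow_le_pow_left₀ (norm_nonneg _) (hC r hr) 2
  have hW : Summable w := by
    rw [summable_iff_cauchySeq_finset, cauchySeq_finset_iff_vanishing_norm]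
    intro ε hε
    obtain ⟨F, hF⟩ := (summable_iff_vanishing_norm.1 hsumm) (ε ^ 2) (by positivity)
    refine ⟨F, fun t ht => ?_⟩
    have h1 := hF t ht
    have h2 := hfin (fun _ => 1) t
    simp only [one_smul, norm_one, one_pow, one_mul] at h2
    rw [← h2, Real.norm_of_nonneg (by positivity)] at h1
    exact lt_of_pow_lt_pow_left₀ 2 hε.le h1
  refine ⟨∑' k, w k, ?_⟩
  rw [tendsto_iff_norm_sub_tendsto_zero]
  have key : Tendsto (fun r : ℝ => ∑' k, ‖((r:ℂ) ^ (k+1)) - 1‖ ^ 2 * ‖w k‖ ^ 2)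
      (𝓝[Set.Ico (0:ℝ) 1] 1) (𝓝 (∑' k : ℕ, (0:ℝ))) := by
    refine tendsto_tsum_of_dominated_convergence hsumm ?_ ?_
    · intro k
      have : Tendsto (fun r : ℝ => ‖((r:ℂ) ^ (k+1)) - 1‖ ^ 2 * ‖w k‖ ^ 2)
        (𝓝[Set.Ico (0:ℝ) 1] 1) (𝓝 (‖(((1:ℝ):ℂ) ^ (k+1)) - 1‖ ^ 2 * ‖w k‖ ^ 2)) := by
        refine Tendsto.mono_left (Continuous.tendsto ?_ _) nhdsWithin_le_nhds
        fun_prop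
      simpa using this
    · refine hmem.mono fun r hr k => ?_
      rw [Real.norm_of_nonneg (by positivity)]
      have h1 : ‖((r:ℂ) ^ (k+1)) - 1‖ ≤ 1 := by
        have e : ((r:ℂ) ^ (k+1)) - 1 = ((r ^ (k+1) - 1 : ℝ) : ℂ) := by push_cast; rfl
        rw [e, Complex.norm_real, Real.norm_eq_abs, abs_le]
        have := pow_nonneg hr.1 (k+1)
        have := pow_le_one₀ hr.1 hr.2.le (n := k+1)
        constructor <;> linarith
      have h2 : ‖((r:ℂ) ^ (k+1)) - 1‖ ^ 2 ≤ 1 := pow_le_one₀ (norm_nonneg _) h1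
      nlinarith [sq_nonneg ‖w k‖]
  have key2 : Tendsto (fun r : ℝ => ‖s r - ∑' k, w k‖ ^ 2) (𝓝[Set.Ico (0:ℝ) 1] 1) (𝓝 0) := by
    rw [tsum_zero] at key
    refine key.congr' (hmem.mono fun r hr => ?_)
    have := hsq (fun k => ((r:ℂ) ^ (k+1)) - 1) (s r - ∑' k, w k) (by
      simpa [sub_smul] using (hs r hr).sub hW.hasSum)
    exact this.tsum_eq
  have := key2.sqrt
  simpa [Real.sqrt_sq] using this

/-- Uniformly bounded operators converging on a set with dense span converge strongly. -/
lemma strong_of_dense {E : Type} [NormedAddCommGroup E] [InnerProductSpace ℂ E] [CompleteSpace E]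
    (T : ℝ → E →L[ℂ] E) (M : ℝ) (hM : 0 ≤ M) (hT : ∀ r ∈ Set.Ico (0:ℝ) 1, ‖T r‖ ≤ M)
    (D : Set E) (hD : ∀ x : E, x ∈ closure (Submodule.span ℂ D : Set E))
    (hconv : ∀ v ∈ D, ∃ W, Tendsto (fun r => T r v) (𝓝[Set.Ico (0:ℝ) 1] 1) (𝓝 W)) :
    ∃ L : E →L[ℂ] E, ∀ x, Tendsto (fun r => T r x) (𝓝[Set.Ico (0:ℝ) 1] 1) (𝓝 (L x)) := by
  haveI hne : (𝓝[Set.Ico (0:ℝ) 1] 1).NeBot := by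
    rw [← mem_closure_iff_nhdsWithin_neBot, closure_Ico (by norm_num)]
    simp
  have hmem : ∀ᶠ r in 𝓝[Set.Ico (0:ℝ) 1] 1, r ∈ Set.Ico (0:ℝ) 1 := self_mem_nhdsWithin
  have hspan : ∀ v ∈ Submodule.span ℂ D,
      ∃ W, Tendsto (fun r => T r v) (𝓝[Set.Ico (0:ℝ) 1] 1) (𝓝 W) := by
    intro v hv
    induction hv using Submodule.span_induction with
    | mem x hx => exact hconv x hx
    | zero => exact ⟨0, by simp⟩
    | add x y _ _ hx hy =>
      obtain ⟨A, hA⟩ := hx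
      obtain ⟨B, hB⟩ := hy
      exact ⟨A + B, by simpa using hA.add hB⟩
    | smul c x _ hx =>
      obtain ⟨A, hA⟩ := hx
      exact ⟨c • A, by simpa using hA.const_smul c⟩
  have hall : ∀ x, ∃ W, Tendsto (fun r => T r x) (𝓝[Set.Ico (0:ℝ) 1] 1) (𝓝 W) := by
    intro x
    apply cauchy_map_iff_exists_tendsto.1
    rw [Metric.cauchy_iff]
    refine ⟨inferInstance, fun ε hε => ?_⟩
    obtain ⟨v, hv, hxv⟩ := Metric.mem_closure_iff.1 (hD x) (ε / (4 * (M + 1))) (by positivity)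
    obtain ⟨W, hW⟩ := hspan v hv
    have h1 := (Metric.tendsto_nhds.1 hW) (ε / 4) (by positivity)
    refine ⟨Metric.ball W (ε / 2), ?_, ?_⟩
    · rw [Filter.mem_map]
      filter_upwards [h1, hmem] with r hr hr'
      have h2 : dist (T r x) (T r v) ≤ ε / 4 := by
        rw [dist_eq_norm, ← map_sub]
        refine (ContinuousLinearMap.le_of_opNorm_le _ (hT r hr') _).trans ?_
        rw [dist_eq_norm] at hxv
        have : M * ‖x - v‖ ≤ (M + 1) * (ε / (4 * (M + 1))) := by
          gcongr; linarith
        refine this.trans (le_of_eq ?_)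
        field_simp
      show dist (T r x) W < ε / 2
      have := dist_triangle (T r x) (T r v) W
      linarith
    · intro y hy z hz
      have := dist_triangle_right y z W
      rw [Metric.mem_ball] at hy hz
      linarith
  choose f hf using hall
  have ht : Tendsto (fun r x => T r x) (𝓝[Set.Ico (0:ℝ) 1] 1) (𝓝 f) := tendsto_pi_nhds.2 hf
  exact ⟨continuousLinearMapOfTendsto T ht, hf⟩

variable {n : ℕ}

/-- Product over a list. -/
def lprod {K : Type} [NormedAddCommGroup K] [InnerProductSpace ℂ K]
    (X : Fin n → K →L[ℂ] K) (l : List (Fin n)) : K →L[ℂ] K := (l.map X).prod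

lemma wordProd_word {K : Type} [NormedAddCommGroup K] [InnerProductSpace ℂ K]
    (X : Fin n → K →L[ℂ] K) {k : ℕ} (f : Fin k → Fin n) :
    wordProd X (word f) = lprod X (List.ofFn f) := rfl

section Hilb
variable {K : Type} [NormedAddCommGroup K] [InnerProductSpace ℂ K] [CompleteSpace K]

lemma lprod_cons_adj (X : Fin n → K →L[ℂ] K) (i : Fin n) (l : List (Fin n)) (h : K) :
    adjoint (lprod X (i :: l)) h = adjoint (lprod X l) (adjoint (X i) h) := by
  have : lprod X (i :: l) = X i ∘L lprod X l := by simp [lprod]; rfl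
  rw [this, adjoint_comp]; rfl

lemma lprod_smul (X : Fin n → K →L[ℂ] K) (c : ℂ) (l : List (Fin n)) :
    lprod (fun i => c • X i) l = c ^ l.length • lprod X l := by
  induction l with
  | nil => simp [lprod]
  | cons i l ih =>
    simp only [lprod, List.map_cons, List.prod_cons, List.length_cons] at ih ⊢
    rw [ih, smul_mul_smul_comm, pow_succ']

lemma truncSum_smul (a : Word n → ℂ) (X : Fin n → K →L[ℂ] K) (r : ℝ) (k : ℕ) :
    truncSum a (fun i => (r:ℂ) • X i) k = (r:ℂ) ^ k • truncSum a X k := by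
  simp only [truncSum, wordProd_word, lprod_smul, List.length_ofFn, Finset.smul_sum]
  exact Finset.sum_congr rfl fun f _ => smul_comm _ _ _

lemma truncSumAdj_smul (a : Word n → ℂ) (X : Fin n → K →L[ℂ] K) (r : ℝ) (k : ℕ) :
    truncSumAdj a (fun i => (r:ℂ) • X i) k = (r:ℂ) ^ k • truncSumAdj a X k := by
  simp only [truncSumAdj, wordProd_word, lprod_smul, List.length_ofFn, Finset.smul_sum]
  refine Finset.sum_congr rfl fun f _ => ?_
  rw [map_smulₛₗ, map_pow, Complex.conj_ofReal]
  exact smul_comm _ _ _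

lemma sum_cons {A : Type*} [AddCommMonoid A] (k : ℕ) (F : List (Fin n) → A) :
    ∑ f : Fin (k+1) → Fin n, F (List.ofFn f)
      = ∑ i, ∑ f : Fin k → Fin n, F (i :: List.ofFn f) := by
  rw [← Fintype.sum_prod_type', ← (Fin.consEquiv (fun _ => Fin n)).sum_comp]
  refine Finset.sum_congr rfl fun p _ => ?_
  simp [Fin.consEquiv, List.ofFn_succ]

/-- `q_k(h)`. -/
def qk (X : Fin n → K →L[ℂ] K) (k : ℕ) (h : K) : ℝ :=
  ∑ f : Fin k → Fin n, ‖adjoint (lprod X (List.ofFn f)) h‖ ^ 2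

lemma qk_zero (X : Fin n → K →L[ℂ] K) (h : K) : qk X 0 h = ‖h‖ ^ 2 := by
  have : adjoint (1 : K →L[ℂ] K) = 1 := star_one _
  simp [qk, lprod, this]

lemma qk_succ (X : Fin n → K →L[ℂ] K) (k : ℕ) (h : K) :
    qk X (k+1) h = ∑ i, qk X k (adjoint (X i) h) := by
  unfold qk
  rw [sum_cons k (fun l => ‖adjoint (lprod X l) h‖ ^ 2)]
  simp only [lprod_cons_adj]

/-- Row contraction condition. -/
def rowC (X : Fin n → K →L[ℂ] K) : Prop := ∀ h, ∑ i, ‖adjoint (X i) h‖ ^ 2 ≤ ‖h‖ ^ 2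

lemma qk_le (X : Fin n → K →L[ℂ] K) (hX : rowC X) (k : ℕ) (h : K) : qk X k h ≤ ‖h‖ ^ 2 := by
  induction k generalizing h with
  | zero => rw [qk_zero]
  | succ k ih => rw [qk_succ]; exact (Finset.sum_le_sum fun i _ => ih _).trans (hX h)

/-- sum of squares of coefficients. -/
def coefSq (a : Word n → ℂ) (k : ℕ) : ℝ := ∑ f : Fin k → Fin n, ‖a (word f)‖ ^ 2

lemma truncSumAdj_norm (a : Word n → ℂ) (X : Fin n → K →L[ℂ] K) (hX : rowC X) (k : ℕ) :
    ‖truncSumAdj a X k‖ ≤ Real.sqrt (coefSq a k) := by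
  refine ContinuousLinearMap.opNorm_le_bound _ (Real.sqrt_nonneg _) fun h => ?_
  simp only [truncSumAdj, wordProd_word, ContinuousLinearMap.sum_apply,
    ContinuousLinearMap.smul_apply]
  calc ‖∑ f : Fin k → Fin n, a (word f) • adjoint (lprod X (List.ofFn f)) h‖
      ≤ ∑ f : Fin k → Fin n, ‖a (word f)‖ * ‖adjoint (lprod X (List.ofFn f)) h‖ := by
        refine (norm_sum_le _ _).trans (le_of_eq ?_)
        simp only [norm_smul]
    _ ≤ Real.sqrt (coefSq a k) * Real.sqrt (qk X k h) := by
        exact Real.sum_mul_le_sqrt_mul_sqrt _ _ _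
    _ ≤ Real.sqrt (coefSq a k) * ‖h‖ := by
        gcongr
        exact Real.sqrt_le_iff.2 ⟨norm_nonneg _, qk_le X hX k h⟩

lemma truncSum_norm (a : Word n → ℂ) (X : Fin n → K →L[ℂ] K) (hX : rowC X) (k : ℕ) :
    ‖truncSum a X k‖ ≤ Real.sqrt (coefSq a k) := by
  have h1 : adjoint (truncSum a X k) = truncSumAdj (fun α => (starRingEnd ℂ) (a α)) X k := by
    simp only [truncSum, truncSumAdj, map_sum, map_smulₛₗ]
  have h2 : ‖truncSum a X k‖ = ‖adjoint (truncSum a X k)‖ := by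
    rw [LinearIsometryEquiv.norm_map]
  rw [h2, h1]
  refine (truncSumAdj_norm _ X hX k).trans (le_of_eq ?_)
  simp [coefSq]

lemma coef_summable (a : Word n → ℂ) (ha : radCond 1 a) (r : ℝ) (hr : r ∈ Set.Ico (0:ℝ) 1) :
    Summable (fun k => r ^ k * Real.sqrt (coefSq a k)) := by
  obtain ⟨hr0, hr1⟩ := hr
  set t : ℝ := 2 / (1 + r) with ht
  have ht1 : 1 < t := by rw [ht, lt_div_iff₀ (by linarith)]; linarith
  have hrt : r * t < 1 := by rw [ht, ← mul_div_assoc, div_lt_one (by linarith)]; linarith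
  unfold radCond at ha
  have hlt := Filter.eventually_lt_of_limsup_lt (lt_of_le_of_lt ha
    (show ENNReal.ofReal (1 / 1) < ENNReal.ofReal t by
      rw [ENNReal.ofReal_lt_ofReal_iff] <;> linarith))
  have hbd : ∀ᶠ k : ℕ in atTop, Real.sqrt (coefSq a k) ≤ t ^ k := by
    filter_upwards [hlt, Filter.eventually_gt_atTop 0] with k hk hk0
    have hsum : (∑ f : Fin k → Fin n, (‖a (word f)‖₊ : ℝ≥0∞) ^ 2)
        = ENNReal.ofReal (coefSq a k) := by
      rw [coefSq, ENNReal.ofReal_sum_of_nonneg (fun _ _ => by positivity)]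
      refine Finset.sum_congr rfl fun f _ => ?_
      rw [ENNReal.ofReal_pow (norm_nonneg _), ofReal_norm_eq_enorm]; rfl
    have hc0 : 0 ≤ coefSq a k := Finset.sum_nonneg fun _ _ => by positivity
    rw [hsum, ENNReal.ofReal_rpow_of_nonneg hc0 (by positivity),
      ENNReal.ofReal_lt_ofReal_iff (by linarith)] at hk
    have hkpos : (0:ℝ) < k := by exact_mod_cast hk0
    have h3 : coefSq a k ≤ (t ^ k) ^ 2 := by
      have h4 : ((coefSq a k) ^ ((1:ℝ) / (2 * k))) ^ (2 * (k:ℝ)) ≤ t ^ (2 * (k:ℝ)) :=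
        Real.rpow_le_rpow (by positivity) hk.le (by positivity)
      rw [← Real.rpow_mul hc0, one_div, inv_mul_cancel₀ (by positivity), Real.rpow_one] at h4
      refine h4.trans (le_of_eq ?_)
      rw [← pow_mul, mul_comm k 2]
      have : (2 * (k:ℝ)) = ((2 * k : ℕ) : ℝ) := by push_cast; rfl
      rw [this, Real.rpow_natCast]
    exact Real.sqrt_le_iff.2 ⟨by positivity, h3⟩
  have hg : Summable (fun k : ℕ => (r * t) ^ k) :=
    summable_geometric_of_lt_one (by positivity) hrt
  refine Summable.of_norm_bounded_eventually_nat hg ?_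
  filter_upwards [hbd] with k hk
  rw [Real.norm_of_nonneg (by positivity), mul_pow]
  gcongr

lemma summable_hol (a : Word n → ℂ) (ha : radCond 1 a) (X : Fin n → K →L[ℂ] K) (hX : rowC X)
    (r : ℝ) (hr : r ∈ Set.Ico (0:ℝ) 1) :
    Summable (fun k => truncSum a (fun i => (r:ℂ) • X i) (k+1)) := by
  refine Summable.of_norm_bounded ((summable_nat_add_iff 1).2 (coef_summable a ha r hr)) ?_
  intro k
  rw [truncSum_smul, norm_smul, norm_pow, Complex.norm_real, Real.norm_of_nonneg hr.1]
  have := hr.1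
  gcongr
  exact truncSum_norm a X hX _

lemma summable_adj (a : Word n → ℂ) (ha : radCond 1 a) (X : Fin n → K →L[ℂ] K) (hX : rowC X)
    (r : ℝ) (hr : r ∈ Set.Ico (0:ℝ) 1) :
    Summable (fun k => truncSumAdj a (fun i => (r:ℂ) • X i) (k+1)) := by
  refine Summable.of_norm_bounded ((summable_nat_add_iff 1).2 (coef_summable a ha r hr)) ?_
  intro k
  rw [truncSumAdj_smul, norm_smul, norm_pow, Complex.norm_real, Real.norm_of_nonneg hr.1]
  have := hr.1
  gcongr
  exact truncSumAdj_norm a X hX _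

lemma hasSum_apply {T : ℕ → K →L[ℂ] K} (h : Summable T) (x : K) :
    HasSum (fun k => T k x) ((∑' k, T k) x) :=
  h.hasSum.mapL (ContinuousLinearMap.apply ℂ K x)

lemma phOp_apply (a b : Word n → ℂ) (X : Fin n → K →L[ℂ] K) (x : K) :
    phOp a b X x = (∑' k : ℕ, truncSumAdj b X (k + 1)) x + a 1 • x
      + (∑' k : ℕ, truncSum a X (k + 1)) x := by
  simp [phOp]

lemma inner_row (X : Fin n → K →L[ℂ] K) (x y : K) :
    inner ℂ ((∑ i, X i * adjoint (X i)) x) y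
      = ∑ i, inner ℂ (adjoint (X i) x) (adjoint (X i) y) := by
  simp only [ContinuousLinearMap.sum_apply, sum_inner]
  refine Finset.sum_congr rfl fun i _ => ?_
  rw [adjoint_inner_right]; rfl

lemma rowC_of_ball (X : Fin n → K →L[ℂ] K) (hX : inClosedBall 1 X) : rowC X := by
  intro h
  have h1 : ∑ i, ‖adjoint (X i) h‖ ^ 2 = RCLike.re (inner ℂ ((∑ i, X i * adjoint (X i)) h) h) := by
    rw [inner_row, map_sum]
    exact Finset.sum_congr rfl fun i _ => (inner_self_eq_norm_sq _).symm
  rw [h1]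
  refine (RCLike.re_le_norm _).trans ((norm_inner_le_norm _ _).trans ?_)
  have h2 := ContinuousLinearMap.le_of_opNorm_le _ hX h
  nlinarith [norm_nonneg h]

lemma ball_of_rowC (X : Fin n → K →L[ℂ] K) (hX : rowC X) (r : ℝ) (hr : r ∈ Set.Ico (0:ℝ) 1) :
    inBall 1 (fun i => (r:ℂ) • X i) := by
  have h1 : ‖∑ i, X i * adjoint (X i)‖ ≤ 1 := by
    refine ContinuousLinearMap.opNorm_le_bound _ zero_le_one fun x => ?_
    set y := (∑ i, X i * adjoint (X i)) x with hy
    have h2 : ‖y‖ ^ 2 ≤ ‖x‖ * ‖y‖ := by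
      calc ‖y‖ ^ 2 = ‖inner ℂ y y‖ := by rw [inner_self_eq_norm_sq_to_K]; simp
        _ = ‖∑ i, inner ℂ (adjoint (X i) x) (adjoint (X i) y)‖ := by
            rw [← inner_row, ← hy]
        _ ≤ ∑ i, ‖adjoint (X i) x‖ * ‖adjoint (X i) y‖ :=
            (norm_sum_le _ _).trans (Finset.sum_le_sum fun i _ => norm_inner_le_norm _ _)
        _ ≤ Real.sqrt (∑ i, ‖adjoint (X i) x‖ ^ 2) * Real.sqrt (∑ i, ‖adjoint (X i) y‖ ^ 2) :=
            Real.sum_mul_le_sqrt_mul_sqrt _ _ _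
        _ ≤ ‖x‖ * ‖y‖ := by
            gcongr
            · exact Real.sqrt_le_iff.2 ⟨norm_nonneg _, hX x⟩
            · exact Real.sqrt_le_iff.2 ⟨norm_nonneg _, hX y⟩
    rcases (norm_nonneg y).eq_or_lt with h | h
    · rw [← h]; positivity
    · nlinarith
  have h3 : ∑ i, ((r:ℂ) • X i) * adjoint ((r:ℂ) • X i)
      = ((r:ℂ) ^ 2) • ∑ i, X i * adjoint (X i) := by
    rw [Finset.smul_sum]
    refine Finset.sum_congr rfl fun i _ => ?_
    rw [map_smulₛₗ, Complex.conj_ofReal, smul_mul_smul_comm, pow_two]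
  unfold inBall
  rw [h3, norm_smul, norm_pow, Complex.norm_real, Real.norm_of_nonneg hr.1]
  have : r ^ 2 < 1 := by nlinarith [hr.1, hr.2]
  nlinarith [sq_nonneg r, norm_nonneg (∑ i, X i * adjoint (X i))]

end Hilb

lemma fock_conv {E : Type} [NormedAddCommGroup E] [InnerProductSpace ℂ E] [CompleteSpace E]
    (S : Fin n → E →L[ℂ] E) (hS : rowC S) (D : Set E)
    (hD : ∀ x : E, x ∈ closure (Submodule.span ℂ D : Set E))
    (a b : Word n → ℂ) (ha : radCond 1 a) (hb : radCond 1 b)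
    (hDv : ∀ v ∈ D, ∃ m : ℕ, (∀ k, m < k → truncSumAdj b S k v = 0) ∧
      ∀ i j : ℕ, i ≠ j → inner ℂ (truncSum a S (i+1) v) (truncSum a S (j+1) v) = 0)
    (M : ℝ) (hM : 0 ≤ M)
    (hbdd : ∀ r ∈ Set.Ico (0:ℝ) 1, ‖phOp a b (fun i => (r:ℂ) • S i)‖ ≤ M) :
    ∃ L : E →L[ℂ] E, ∀ x,
      Tendsto (fun r : ℝ => phOp a b (fun i => (r:ℂ) • S i) x)
        (𝓝[Set.Ico (0:ℝ) 1] 1) (𝓝 (L x)) := by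
  refine strong_of_dense _ M hM hbdd D hD ?_
  · intro v hvD
    obtain ⟨m, hv, hv'⟩ := hDv v hvD
    have hmem : ∀ᶠ r in 𝓝[Set.Ico (0:ℝ) 1] 1, r ∈ Set.Ico (0:ℝ) 1 := self_mem_nhdsWithin
    set P : ℝ → E := fun r =>
      ∑ k ∈ Finset.range m, ((r:ℂ) ^ (k+1)) • truncSumAdj b S (k+1) v with hP
    have hadj : ∀ r ∈ Set.Ico (0:ℝ) 1,
        (∑' k : ℕ, truncSumAdj b (fun i => (r:ℂ) • S i) (k + 1)) v = P r := by
      intro r hr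
      refine (hasSum_apply (summable_adj b hb S hS r hr) v).unique ?_
      simp only [truncSumAdj_smul]
      refine hasSum_sum_of_ne_finset_zero fun k hk => ?_
      have : truncSumAdj b S (k+1) v = 0 :=
        hv _ (by simp at hk; omega)
      simp [this]
    set s : ℝ → E := fun r =>
      (∑' k : ℕ, truncSum a (fun i => (r:ℂ) • S i) (k + 1)) v with hs
    have hcontP : Continuous P := by
      rw [hP]; fun_prop
    obtain ⟨W, hW⟩ := orth_abel (fun k => truncSum a S (k+1) v)
      hv'
      s (M * ‖v‖ + ‖a 1 • v‖ + ∑ k ∈ Finset.range m, ‖truncSumAdj b S (k+1) v‖)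
      (by
        intro r hr
        have := hasSum_apply (summable_hol a ha S hS r hr) v
        convert this using 1
        funext k
        rw [truncSum_smul]; rfl)
      (by
        intro r hr
        have h1 := phOp_apply a b (fun i => (r:ℂ) • S i) v
        rw [hadj r hr] at h1
        have h2 : s r = phOp a b (fun i => (r:ℂ) • S i) v - a 1 • v - P r := by
          rw [h1]; simp only [hs]; abel
        rw [h2]
        refine (norm_sub_le _ _).trans (add_le_add ((norm_sub_le _ _).trans
          (add_le_add_left (ContinuousLinearMap.le_of_opNorm_le _ (hbdd r hr) v) _)) ?_)
        refine (norm_sum_le _ _).trans (Finset.sum_le_sum fun k _ => ?_)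
        rw [norm_smul, norm_pow, Complex.norm_real, Real.norm_of_nonneg hr.1]
        exact mul_le_of_le_one_left (norm_nonneg _) (pow_le_one₀ hr.1 hr.2.le))
    refine ⟨P 1 + a 1 • v + W, ?_⟩
    have ht : Tendsto (fun r => P r + a 1 • v + s r) (𝓝[Set.Ico (0:ℝ) 1] 1)
        (𝓝 (P 1 + a 1 • v + W)) :=
      (((hcontP.tendsto 1).mono_left nhdsWithin_le_nhds).add tendsto_const_nhds).add hW
    refine ht.congr' (hmem.mono fun r hr => ?_)
    show _ = phOp a b (fun i => (r:ℂ) • S i) v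
    rw [phOp_apply, hadj r hr]

section Fock
variable (n)
variable (H : Type) [NormedAddCommGroup H] [InnerProductSpace ℂ H]

/-- The full Fock space with multiplicity `H`. -/
abbrev Fock : Type := lp (fun _ : List (Fin n) => H) 2

variable {n} {H}

lemma fock_hasSum (x : Fock n H) : HasSum (fun β => ‖x β‖ ^ 2) (‖x‖ ^ 2) := by
  have := lp.hasSum_norm (p := 2) (by norm_num) x
  simpa using this

lemma fock_mem (f : List (Fin n) → H) (h : Summable fun β => ‖f β‖ ^ 2) :
    Memℓp f 2 := by
  rw [memℓp_gen_iff (by norm_num)]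
  simpa using h

lemma cons_summable (x : Fock n H) (i : Fin n) : Summable fun β => ‖x (i :: β)‖ ^ 2 :=
  (fock_hasSum x).summable.comp_injective (List.cons_injective (a := i))

/-- backward shift as linear map. -/
def shiftL (i : Fin n) : Fock n H →ₗ[ℂ] Fock n H where
  toFun x := ⟨fun β => x (i :: β), fock_mem _ (cons_summable x i)⟩
  map_add' x y := by ext β; rfl
  map_smul' c x := by ext β; rfl

lemma shiftL_sum (x : Fock n H) : ∑ i, ‖shiftL i x‖ ^ 2 ≤ ‖x‖ ^ 2 := by
  have h1 : ∀ i, ‖shiftL i x‖ ^ 2 = ∑' β, ‖x (i :: β)‖ ^ 2 := fun i =>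
    (fock_hasSum (shiftL i x)).tsum_eq.symm
  have hinj : Function.Injective (fun p : (_ : Fin n) × List (Fin n) => p.1 :: p.2) := by
    rintro ⟨i, β⟩ ⟨j, γ⟩ h
    simp only [List.cons.injEq] at h
    obtain ⟨rfl, rfl⟩ := h
    rfl
  have hs : Summable (fun p : (_ : Fin n) × List (Fin n) => ‖x (p.1 :: p.2)‖ ^ 2) :=
    (fock_hasSum x).summable.comp_injective hinj
  have h2 : ∑' p : (_ : Fin n) × List (Fin n), ‖x (p.1 :: p.2)‖ ^ 2
      = ∑ i, ∑' β, ‖x (i :: β)‖ ^ 2 :=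
    (Summable.tsum_sigma' (fun i => cons_summable x i) hs).trans (tsum_fintype _)
  simp only [h1]
  rw [← h2, ← (fock_hasSum x).tsum_eq]
  exact Summable.tsum_le_tsum_of_inj _ hinj (fun _ _ => by positivity) (fun _ => le_rfl) hs
    (fock_hasSum x).summable

lemma shiftL_le (i : Fin n) (x : Fock n H) : ‖shiftL i x‖ ≤ 1 * ‖x‖ := by
  have h1 : ‖shiftL i x‖ ^ 2 ≤ ‖x‖ ^ 2 :=
    (Finset.single_le_sum (f := fun i => ‖shiftL i x‖ ^ 2) (fun _ _ => by positivity)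
      (Finset.mem_univ i)).trans (shiftL_sum x)
  rw [one_mul]
  exact le_of_sq_le_sq h1 (norm_nonneg _)

/-- backward shift. -/
def shiftV (i : Fin n) : Fock n H →L[ℂ] Fock n H := (shiftL i).mkContinuous 1 (shiftL_le i)

variable [CompleteSpace H]

/-- creation operators. -/
def creat (i : Fin n) : Fock n H →L[ℂ] Fock n H := adjoint (shiftV i)

lemma creat_adj (i : Fin n) : adjoint (creat (H := H) i) = shiftV i := adjoint_adjoint _

lemma creat_adj_apply (i : Fin n) (x : Fock n H) (β : List (Fin n)) :
    (adjoint (creat (H := H) i) x) β = x (i :: β) := by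
  rw [creat_adj]; rfl

lemma creat_row : rowC (creat (n := n) (H := H)) := by
  intro x
  simp only [creat_adj]
  exact shiftL_sum x

lemma lprod_creat_adj (l : List (Fin n)) (x : Fock n H) (β : List (Fin n)) :
    (adjoint (lprod creat l) x) β = x (l ++ β) := by
  induction l generalizing x with
  | nil =>
    have : adjoint (1 : Fock n H →L[ℂ] Fock n H) = 1 := star_one _
    simp [lprod, this]
  | cons i l ih => rw [lprod_cons_adj, ih, creat_adj_apply]; rfl

/-- homogeneous vectors -/
def hom (m : ℕ) (x : Fock n H) : Prop := ∀ β : List (Fin n), β.length ≠ m → x β = 0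

lemma hom_inner {m m' : ℕ} (hm : m ≠ m') {x y : Fock n H} (hx : hom m x) (hy : hom m' y) :
    inner ℂ x y = 0 := by
  rw [lp.inner_eq_tsum]
  have : ∀ β, inner ℂ (x β) (y β) = 0 := by
    intro β
    by_cases h : β.length = m
    · rw [hy β (by omega)]; simp
    · rw [hx β h]; simp
  simp [this]

lemma creat_hom {m : ℕ} {x : Fock n H} (hx : hom m x) (i : Fin n) : hom (m+1) (creat i x) := by
  intro β hβ
  classical
  refine ext_inner_left ℂ fun d => ?_
  have e := lp.inner_single_left (𝕜 := ℂ) (G := fun _ : List (Fin n) => H) β d (creat i x)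
  rw [inner_zero_right]
  refine e.symm.trans ?_
  rw [← adjoint_inner_left]
  have : hom (H := H) (n := n) (β.length - 1) (adjoint (creat i) (lp.single 2 β d)) := by
    intro γ hγ
    rw [creat_adj_apply, lp.single_apply_ne]
    rintro rfl
    simp at hγ
  by_cases hb : β.length = 0
  · have h0 : adjoint (creat i) (lp.single 2 β d : Fock n H) = 0 := by
      ext γ
      rw [creat_adj_apply, lp.single_apply_ne]
      · rfl
      · rintro rfl
        simp at hb
    rw [h0, inner_zero_left]
  · exact hom_inner (by omega) this hx

lemma lprod_hom {m : ℕ} {x : Fock n H} (hx : hom m x) (l : List (Fin n)) :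
    hom (m + l.length) (lprod creat l x) := by
  induction l with
  | nil => simpa [lprod] using hx
  | cons i l ih =>
    have : lprod creat (i :: l) x = creat i (lprod creat l x) := by simp [lprod]
    rw [this]
    exact creat_hom ih i

lemma truncSum_hom (a : Word n → ℂ) {m : ℕ} {x : Fock n H} (hx : hom m x) (k : ℕ) :
    hom (m + k) (truncSum a creat k x) := by
  intro β hβ
  have : (truncSum a creat k x) = ∑ f : Fin k → Fin n, a (word f) • lprod creat (List.ofFn f) x := by
    simp [truncSum, wordProd_word]
  rw [this, lp.coeFn_sum, Finset.sum_apply]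
  refine Finset.sum_eq_zero fun f _ => ?_
  have h := lprod_hom hx (List.ofFn f) β (by simpa using hβ)
  rw [lp.coeFn_smul, Pi.smul_apply, h, smul_zero]

lemma truncSumAdj_hom (b : Word n → ℂ) {m : ℕ} {x : Fock n H} (hx : hom m x) (k : ℕ)
    (hk : m < k) : truncSumAdj b creat k x = 0 := by
  have : (truncSumAdj b creat k x)
      = ∑ f : Fin k → Fin n, b (word f) • adjoint (lprod creat (List.ofFn f)) x := by
    simp [truncSumAdj, wordProd_word]
  rw [this]
  refine Finset.sum_eq_zero fun f _ => ?_
  have h0 : adjoint (lprod creat (List.ofFn f)) x = 0 := by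
    ext β
    rw [lprod_creat_adj, hx _ (by simp; omega)]
    rfl
  rw [h0, smul_zero]

lemma fock_dense (x : Fock n H) :
    x ∈ closure (Submodule.span ℂ {v : Fock n H | ∃ m, hom m v} : Set (Fock n H)) := by
  classical
  have h := lp.hasSum_single (p := 2) (by norm_num) x
  refine mem_closure_of_tendsto h (Filter.Eventually.of_forall fun F => ?_)
  refine Submodule.sum_mem _ fun β _ => Submodule.subset_span ⟨β.length, ?_⟩
  intro γ hγ
  rw [lp.single_apply_ne]
  rintro rfl
  exact hγ rfl

end Fock

section Dil
variable {H : Type} [NormedAddCommGroup H] [InnerProductSpace ℂ H] [CompleteSpace H]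

lemma exists_defect (X : Fin n → H →L[ℂ] H) (hX : rowC X) :
    ∃ D : H →L[ℂ] H, ∀ h, ‖D h‖ ^ 2 = ‖h‖ ^ 2 - ∑ i, ‖adjoint (X i) h‖ ^ 2 := by
  have hre : ∀ h, RCLike.re (inner ℂ ((1 - ∑ i, X i * adjoint (X i) : H →L[ℂ] H) h) h)
      = ‖h‖ ^ 2 - ∑ i, ‖adjoint (X i) h‖ ^ 2 := by
    intro h
    rw [ContinuousLinearMap.sub_apply, inner_sub_left, inner_row, map_sub, map_sum]
    congr 1
    · exact inner_self_eq_norm_sq _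
    · exact Finset.sum_congr rfl fun i _ => inner_self_eq_norm_sq _
  have hpos : 0 ≤ (1 - ∑ i, X i * adjoint (X i) : H →L[ℂ] H) := by
    rw [ContinuousLinearMap.nonneg_iff_isPositive, ContinuousLinearMap.isPositive_def']
    refine ⟨?_, fun h => ?_⟩
    · refine (IsSelfAdjoint.one _).sub ?_
      refine isSelfAdjoint_sum _ fun i _ => ?_
      exact IsSelfAdjoint.mul_star_self (X i)
    · rw [ContinuousLinearMap.reApplyInnerSelf_apply, hre]
      linarith [hX h]
  obtain ⟨D, hD⟩ := CStarAlgebra.nonneg_iff_eq_star_mul_self.1 hpos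
  refine ⟨D, fun h => ?_⟩
  rw [← hre, hD, ← inner_self_eq_norm_sq (𝕜 := ℂ) (D h)]
  congr 1
  exact (adjoint_inner_left D h (D h)).symm

lemma exists_dilation (X : Fin n → H →L[ℂ] H) (hX : rowC X)
    (hpure : ∀ h, Tendsto (fun k => qk X k h) atTop (𝓝 0)) :
    ∃ J : H →L[ℂ] Fock n H, adjoint J ∘L J = 1 ∧
      ∀ l h, J (adjoint (lprod X l) h) = adjoint (lprod creat l) (J h) := by
  obtain ⟨D, hD⟩ := exists_defect X hX
  have hp : ∀ k h, ∑ f : Fin k → Fin n, ‖D (adjoint (lprod X (List.ofFn f)) h)‖ ^ 2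
      = qk X k h - qk X (k+1) h := by
    intro k
    induction k with
    | zero =>
      intro h
      have : adjoint (1 : H →L[ℂ] H) = 1 := star_one _
      rw [qk_succ]
      simp only [qk_zero]
      simp [lprod, this, hD]
    | succ k ih =>
      intro h
      rw [sum_cons k (fun l => ‖D (adjoint (lprod X l) h)‖ ^ 2), qk_succ X (k+1), qk_succ X k,
        ← Finset.sum_sub_distrib]
      simp only [lprod_cons_adj, ih]
  have hsum : ∀ h, HasSum (fun l : List (Fin n) => ‖D (adjoint (lprod X l) h)‖ ^ 2) (‖h‖ ^ 2) := by
    intro h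
    rw [← (List.equivSigmaTuple (α := Fin n)).symm.hasSum_iff]
    have hk : HasSum (fun k => qk X k h - qk X (k+1) h) (‖h‖ ^ 2) := by
      rw [hasSum_iff_tendsto_nat_of_nonneg]
      · simp only [Finset.sum_range_sub']
        simpa [qk_zero] using (hpure h).const_sub (qk X 0 h)
      · intro k; rw [← hp]; positivity
    have hk' : HasSum (fun k => ∑' f : Fin k → Fin n,
        ‖D (adjoint (lprod X (List.ofFn f)) h)‖ ^ 2) (‖h‖ ^ 2) := by
      simpa only [tsum_fintype, hp] using hk
    have hs : Summable ((fun l : List (Fin n) => ‖D (adjoint (lprod X l) h)‖ ^ 2) ∘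
        (List.equivSigmaTuple (α := Fin n)).symm) := by
      rw [summable_sigma_of_nonneg (fun _ => by simp only [Function.comp]; positivity)]
      exact ⟨fun k => (hasSum_fintype _).summable, hk'.summable⟩
    have h3 := Summable.tsum_sigma' (fun k => (hasSum_fintype _).summable) hs
    rw [hs.hasSum_iff, h3]
    exact hk'.tsum_eq
  let J0 : H →ₗ[ℂ] Fock n H :=
    { toFun := fun h => ⟨fun l => D (adjoint (lprod X l) h), fock_mem _ (hsum h).summable⟩
      map_add' := fun x y => by
        ext l
        show D (adjoint (lprod X l) (x + y)) = D (adjoint (lprod X l) x) + D (adjoint (lprod X l) y)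
        rw [map_add, map_add]
      map_smul' := fun c x => by
        ext l
        show D (adjoint (lprod X l) (c • x)) = c • D (adjoint (lprod X l) x)
        rw [map_smul, map_smul] }
  have hnorm : ∀ h, ‖J0 h‖ = ‖h‖ := by
    intro h
    have : ‖J0 h‖ ^ 2 = ‖h‖ ^ 2 := (fock_hasSum (J0 h)).unique (hsum h)
    exact (pow_left_inj₀ (norm_nonneg _) (norm_nonneg _) two_ne_zero).1 this
  let J : H →L[ℂ] Fock n H := J0.mkContinuous 1 (fun h => by rw [hnorm, one_mul])
  refine ⟨J, (ContinuousLinearMap.norm_map_iff_adjoint_comp_self J).1 hnorm, ?_⟩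
  intro l h
  ext β
  rw [lprod_creat_adj]
  show D (adjoint (lprod X β) (adjoint (lprod X l) h)) = D (adjoint (lprod X (l ++ β)) h)
  have : lprod X (l ++ β) = lprod X l ∘L lprod X β := by simp [lprod]; rfl
  rw [this, adjoint_comp]; rfl

lemma exists_model (a b : Word n → ℂ) (X : Fin n → H →L[ℂ] H) (hX : rowC X)
    (hpure : ∀ h, Tendsto (fun k => qk X k h) atTop (𝓝 0)) :
    ∃ (E : Type) (_ : NormedAddCommGroup E) (_ : InnerProductSpace ℂ E) (_ : CompleteSpace E)
      (S : Fin n → E →L[ℂ] E) (J : H →L[ℂ] E) (D : Set E), rowC S ∧ adjoint J ∘L J = 1 ∧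
      (∀ l h, J (adjoint (lprod X l) h) = adjoint (lprod S l) (J h)) ∧
      (∀ x : E, x ∈ closure (Submodule.span ℂ D : Set E)) ∧
      (∀ v ∈ D, ∃ m : ℕ, (∀ k, m < k → truncSumAdj b S k v = 0) ∧
      ∀ i j : ℕ, i ≠ j → inner ℂ (truncSum a S (i+1) v) (truncSum a S (j+1) v) = 0) := by
  obtain ⟨J, hJ, hJX⟩ := exists_dilation X hX hpure
  refine ⟨Fock n H, inferInstance, inferInstance, inferInstance, creat, J,
    {v | ∃ m, hom m v}, creat_row, hJ, hJX, fock_dense, ?_⟩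
  rintro v ⟨m, hv⟩
  exact ⟨m, fun k hk => truncSumAdj_hom b hv k hk, fun i j hij =>
    hom_inner (by omega) (truncSum_hom a hv (i+1)) (truncSum_hom a hv (j+1))⟩

lemma phOp_dil {E : Type} [NormedAddCommGroup E] [InnerProductSpace ℂ E] [CompleteSpace E]
    (S : Fin n → E →L[ℂ] E) (hS : rowC S) (a b : Word n → ℂ) (ha : radCond 1 a) (hb : radCond 1 b)
    (X : Fin n → H →L[ℂ] H) (hX : rowC X)
    (J : H →L[ℂ] E) (hJ : adjoint J ∘L J = 1)
    (hJX : ∀ l h, J (adjoint (lprod X l) h) = adjoint (lprod S l) (J h))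
    (r : ℝ) (hr : r ∈ Set.Ico (0:ℝ) 1) (h : H) :
    phOp a b (fun i => (r:ℂ) • X i) h
      = adjoint J (phOp a b (fun i => (r:ℂ) • S i) (J h)) := by
  have hJ' : ∀ x, adjoint J (J x) = x := fun x => by
    have := congrArg (fun T : H →L[ℂ] H => T x) hJ
    simpa using this
  have hJX' : ∀ l h, lprod X l h = adjoint J (lprod S l (J h)) := by
    intro l h
    refine ext_inner_right ℂ fun y => ?_
    rw [adjoint_inner_left, ← adjoint_inner_right (lprod S l), ← hJX, ← adjoint_inner_left J,
      hJ', adjoint_inner_right]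
  rw [phOp_apply, phOp_apply, map_add, map_add, map_smul, hJ']
  congr 1
  · congr 1
    refine (hasSum_apply (summable_adj b hb X hX r hr) h).unique ?_
    have := (hasSum_apply (summable_adj b hb S hS r hr) (J h)).mapL (adjoint J)
    convert this using 1
    funext k
    rw [truncSumAdj_smul, truncSumAdj_smul]
    show (r:ℂ) ^ (k+1) • (truncSumAdj b X (k+1) h) = adjoint J ((r:ℂ) ^ (k+1) • truncSumAdj b S (k+1) (J h))
    rw [map_smul]
    congr 1
    simp only [truncSumAdj, wordProd_word, ContinuousLinearMap.smul_apply, ContinuousLinearMap.sum_apply,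
      map_smul, map_sum, ← hJX, hJ']
  · refine (hasSum_apply (summable_hol a ha X hX r hr) h).unique ?_
    have := (hasSum_apply (summable_hol a ha S hS r hr) (J h)).mapL (adjoint J)
    convert this using 1
    funext k
    rw [truncSum_smul, truncSum_smul]
    show (r:ℂ) ^ (k+1) • (truncSum a X (k+1) h) = adjoint J ((r:ℂ) ^ (k+1) • truncSum a S (k+1) (J h))
    rw [map_smul]
    congr 1
    simp only [truncSum, wordProd_word, ContinuousLinearMap.smul_apply, ContinuousLinearMap.sum_apply,
      map_smul, map_sum, hJX']

end Dil

end Helpers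

/-- Fatou-type theorem: for a bounded free pluriharmonic function `u` and a
pure `n`-tuple `X` in the closed unit ball, the strong operator limit of `u(rX)` as
`r → 1⁻` exists. -/
theorem stmt_9 (n : ℕ) (hn : 1 ≤ n)
    (a b : Word n → ℂ) (ha : radCond 1 a) (hb : radCond 1 b)
    (M : ℝ) (hM : 0 ≤ M)
    (hbdd : ∀ (K : Type) [NormedAddCommGroup K] [InnerProductSpace ℂ K] [CompleteSpace K]
      (X : Fin n → K →L[ℂ] K), inBall 1 X → ‖phOp a b X‖ ≤ M)
    (H : Type) [NormedAddCommGroup H] [InnerProductSpace ℂ H] [CompleteSpace H]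
    (X : Fin n → H →L[ℂ] H) (hX : inClosedBall 1 X)
    (hpure : ∀ h : H,
      Tendsto (fun k : ℕ =>
          (∑ f : Fin k → Fin n, wordProd X (word f) * adjoint (wordProd X (word f))) h)
        atTop (nhds 0)) :
    ∃ L : H →L[ℂ] H, ∀ h : H,
      Tendsto (fun r : ℝ => phOp a b (fun i => (r : ℂ) • X i) h)
        (nhdsWithin 1 (Set.Ico (0 : ℝ) 1)) (nhds (L h)) := by
  have hrow : rowC X := rowC_of_ball X hX
  have hp : ∀ h, Tendsto (fun k => qk X k h) atTop (nhds 0) := by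
    intro h
    have h1 : ∀ k, qk X k h = RCLike.re (inner ℂ ((∑ f : Fin k → Fin n,
        wordProd X (word f) * adjoint (wordProd X (word f))) h) h) := by
      intro k
      rw [_root_.sum_apply, sum_inner, map_sum]
      refine Finset.sum_congr rfl fun f _ => ?_
      rw [← inner_self_eq_norm_sq (𝕜 := ℂ), adjoint_inner_right]
      rfl
    rw [funext h1]
    have h2 := RCLike.continuous_re.tendsto _ |>.comp ((hpure h).inner (𝕜 := ℂ)
      (tendsto_const_nhds (x := h)))
    rw [inner_zero_left, RCLike.zero_re] at h2
    exact h2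
  obtain ⟨E, _, _, _, S, J, D, hS, hJ, hJX, hD, hDv⟩ := exists_model a b X hrow hp
  obtain ⟨L, hL⟩ := fock_conv S hS D hD a b ha hb hDv M hM
    (fun r hr => hbdd E _ (ball_of_rowC S hS r hr))
  refine ⟨adjoint J ∘L L ∘L J, fun h => ?_⟩
  have h1 := ((adjoint J).continuous.tendsto _).comp (hL (J h))
  refine h1.congr' ?_
  filter_upwards [self_mem_nhdsWithin] with r hr
  exact (phOp_dil S hS a b ha hb X hrow J hJ hJX r hr h).symm

end
end
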